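/- arXiv:2111.14284 — 2 statements merged into one kernel-verified Lean document; each statement's English description precedes it below -/
import Mathlib

section
/- For every integer n ≥ 2 there exists a constant c₀ = c₀(n), depending only on n, such that pc(G) ≤ c₀ for every connected {K*_n, K_{1,n}, F^(1)_n, F^(2)_n}-free graph G. -/
/-! ## Basic notions for graphs and digraphs

A digraph on a vertex type `V` is given by its arc relation `E : V → V → Prop`.
Simplicity and absence of 2-cycles is expressed by the hypothesis
`∀ u v, E u v → ¬ E v u`.  The underlying graph `G_D` is `SimpleGraph.fromRel E`. -/

/-- `G` contains an induced copy of the simple graph `H`. -/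
def HasInducedCopyG {W V : Type} (H : SimpleGraph W) (G : SimpleGraph V) : Prop :=
  ∃ f : W → V, Function.Injective f ∧ ∀ a b : W, G.Adj (f a) (f b) ↔ H.Adj a b

/-- The digraph `E` contains an induced copy of the digraph `H`. -/
def DigraphHasInducedCopy {W V : Type} (H : W → W → Prop) (E : V → V → Prop) : Prop :=
  ∃ f : W → V, Function.Injective f ∧ ∀ a b : W, E (f a) (f b) ↔ H a b

/-- The star `K_{1,n}` with one center and `n` leaves. -/
def StarG (n : ℕ) : SimpleGraph (Unit ⊕ Fin n) :=
  SimpleGraph.fromRel (fun a b =>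
    match a, b with
    | Sum.inl _, Sum.inr _ => True
    | _, _ => False)

/-- The path `P_n` of order `n`. -/
def PathG (n : ℕ) : SimpleGraph (Fin n) :=
  SimpleGraph.fromRel (fun i j => i.val + 1 = j.val)

/-- The graph `K*_n`: a complete graph on the `x_i` together with pendant edges `x_i y_i`. -/
def KStarG (n : ℕ) : SimpleGraph (Fin n ⊕ Fin n) :=
  SimpleGraph.fromRel (fun a b =>
    match a, b with
    | Sum.inl i, Sum.inl j => i ≠ j
    | Sum.inl i, Sum.inr j => i = j
    | _, _ => False)

/-- The graph `F^(1)_n` on `{x₁,x₂} ∪ {yᵢ} ∪ {zᵢ}`: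
edges `x₁x₂, x₁y₁, x₁z₁` together with the two paths `y₁⋯y_n` and `z₁⋯z_n`. -/
def F1G (n : ℕ) : SimpleGraph (Fin 2 ⊕ Fin n ⊕ Fin n) :=
  SimpleGraph.fromRel (fun a b =>
    match a, b with
    | Sum.inl i, Sum.inl j => i.val = 0 ∧ j.val = 1
    | Sum.inl i, Sum.inr (Sum.inl j) => i.val = 0 ∧ j.val = 0
    | Sum.inl i, Sum.inr (Sum.inr j) => i.val = 0 ∧ j.val = 0
    | Sum.inr (Sum.inl i), Sum.inr (Sum.inl j) => i.val + 1 = j.val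
    | Sum.inr (Sum.inr i), Sum.inr (Sum.inr j) => i.val + 1 = j.val
    | _, _ => False)

/-- The single edge `y₁z₁` (used to build `F^(2)_n` and `F^(4)_n`). -/
def YZEdgeG (n : ℕ) : SimpleGraph (Fin 2 ⊕ Fin n ⊕ Fin n) :=
  SimpleGraph.fromRel (fun a b =>
    match a, b with
    | Sum.inr (Sum.inl i), Sum.inr (Sum.inr j) => i.val = 0 ∧ j.val = 0
    | _, _ => False)

/-- `F^(2)_n = F^(1)_n + y₁z₁`. -/
def F2G (n : ℕ) : SimpleGraph (Fin 2 ⊕ Fin n ⊕ Fin n) := F1G n ⊔ YZEdgeG n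

/-- The graph `F^(3)_n`: edges `x₁y₁, x₁z₁, x₂y₁, x₂z₁` together with the two paths. -/
def F3G (n : ℕ) : SimpleGraph (Fin 2 ⊕ Fin n ⊕ Fin n) :=
  SimpleGraph.fromRel (fun a b =>
    match a, b with
    | Sum.inl _, Sum.inr (Sum.inl j) => j.val = 0
    | Sum.inl _, Sum.inr (Sum.inr j) => j.val = 0
    | Sum.inr (Sum.inl i), Sum.inr (Sum.inl j) => i.val + 1 = j.val
    | Sum.inr (Sum.inr i), Sum.inr (Sum.inr j) => i.val + 1 = j.val
    | _, _ => False)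

/-- `F^(4)_n = F^(3)_n + y₁z₁`. -/
def F4G (n : ℕ) : SimpleGraph (Fin 2 ⊕ Fin n ⊕ Fin n) := F3G n ⊔ YZEdgeG n

/-- The digraph `D^(1)_n` on `{x₁} ∪ {yᵢ} ∪ {zᵢ}` with arcs
`(x₁,y₁), (z₁,x₁), (y₁,z₁)`, `(y_{i+1}, y_i)` and `(z_i, z_{i+1})`. -/
def D1Rel (n : ℕ) : (Unit ⊕ Fin n ⊕ Fin n) → (Unit ⊕ Fin n ⊕ Fin n) → Prop := fun a b =>
  match a, b with
  | Sum.inl _, Sum.inr (Sum.inl j) => j.val = 0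
  | Sum.inr (Sum.inr i), Sum.inl _ => i.val = 0
  | Sum.inr (Sum.inl i), Sum.inr (Sum.inr j) => i.val = 0 ∧ j.val = 0
  | Sum.inr (Sum.inl i), Sum.inr (Sum.inl j) => j.val + 1 = i.val
  | Sum.inr (Sum.inr i), Sum.inr (Sum.inr j) => i.val + 1 = j.val
  | _, _ => False

/-- `D^(2)_n`: obtained from `D^(1)_n` by replacing the arc `(z₁,x₁)` by `(x₁,z₁)`. -/
def D2Rel (n : ℕ) : (Unit ⊕ Fin n ⊕ Fin n) → (Unit ⊕ Fin n ⊕ Fin n) → Prop := fun a b =>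
  match a, b with
  | Sum.inl _, Sum.inr (Sum.inl j) => j.val = 0
  | Sum.inl _, Sum.inr (Sum.inr j) => j.val = 0
  | Sum.inr (Sum.inl i), Sum.inr (Sum.inr j) => i.val = 0 ∧ j.val = 0
  | Sum.inr (Sum.inl i), Sum.inr (Sum.inl j) => j.val + 1 = i.val
  | Sum.inr (Sum.inr i), Sum.inr (Sum.inr j) => i.val + 1 = j.val
  | _, _ => False

/-- `D^(3)_n`: obtained from `D^(1)_n` by replacing the arc `(x₁,y₁)` by `(y₁,x₁)`. -/
def D3Rel (n : ℕ) : (Unit ⊕ Fin n ⊕ Fin n) → (Unit ⊕ Fin n ⊕ Fin n) → Prop := fun a b =>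
  match a, b with
  | Sum.inr (Sum.inl i), Sum.inl _ => i.val = 0
  | Sum.inr (Sum.inr i), Sum.inl _ => i.val = 0
  | Sum.inr (Sum.inl i), Sum.inr (Sum.inr j) => i.val = 0 ∧ j.val = 0
  | Sum.inr (Sum.inl i), Sum.inr (Sum.inl j) => j.val + 1 = i.val
  | Sum.inr (Sum.inr i), Sum.inr (Sum.inr j) => i.val + 1 = j.val
  | _, _ => False

/-- The transitive tournament `T_n`. -/
def TRel (n : ℕ) : Fin n → Fin n → Prop := fun i j => i < j

/-- A (nonempty) directed path in the digraph `E`, recorded as its list of vertices. -/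
def IsDirPathList {V : Type} (E : V → V → Prop) (l : List V) : Prop :=
  l ≠ [] ∧ l.Nodup ∧ l.Chain' E

/-- The path cover number of the subdigraph of `E` induced by `X`:
the minimum number of directed paths of `E[X]` whose vertex sets cover `X`. -/
noncomputable def pcOn {V : Type} (E : V → V → Prop) (X : Set V) : ℕ :=
  sInf {k | ∃ P : Finset (List V), P.card = k ∧
    (∀ l ∈ P, IsDirPathList E l ∧ ∀ v ∈ l, v ∈ X) ∧
    ∀ v ∈ X, ∃ l ∈ P, v ∈ l}

/-- The path partition number of the subdigraph of `E` induced by `X`: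
the minimum number of pairwise vertex-disjoint directed paths of `E[X]`
whose vertex sets partition `X`. -/
noncomputable def ppOn {V : Type} (E : V → V → Prop) (X : Set V) : ℕ :=
  sInf {k | ∃ P : Finset (List V), P.card = k ∧
    (∀ l ∈ P, IsDirPathList E l ∧ ∀ v ∈ l, v ∈ X) ∧
    (∀ v ∈ X, ∃ l ∈ P, v ∈ l) ∧
    ∀ l ∈ P, ∀ l' ∈ P, l ≠ l' → ∀ v ∈ l, v ∉ l'}

/-- A (nonempty) path in the simple graph `G`, recorded as its list of vertices. -/
def IsPathList {V : Type} (G : SimpleGraph V) (l : List V) : Prop :=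
  l ≠ [] ∧ l.Nodup ∧ l.Chain' G.Adj

/-- The path cover number `pc(G)` of a simple graph `G`. -/
noncomputable def pcG {V : Type} (G : SimpleGraph V) : ℕ :=
  sInf {k | ∃ P : Finset (List V), P.card = k ∧
    (∀ l ∈ P, IsPathList G l) ∧ ∀ v : V, ∃ l ∈ P, v ∈ l}

/-- The path partition number `pp(G)` of a simple graph `G`. -/
noncomputable def ppG {V : Type} (G : SimpleGraph V) : ℕ :=
  sInf {k | ∃ P : Finset (List V), P.card = k ∧
    (∀ l ∈ P, IsPathList G l) ∧ (∀ v : V, ∃ l ∈ P, v ∈ l) ∧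
    ∀ l ∈ P, ∀ l' ∈ P, l ≠ l' → ∀ v ∈ l, v ∉ l'}

/-- A directed cycle in the digraph `E`, recorded as its list of vertices. -/
def IsDirCycleList {V : Type} (E : V → V → Prop) (l : List V) : Prop :=
  ∃ h : l ≠ [], 3 ≤ l.length ∧ l.Nodup ∧ l.Chain' E ∧ E (l.getLast h) (l.head h)

/-- A member of a cycle cover/partition: a directed cycle, or a weakly connected
subdigraph of order at most two. -/
def IsCyclePartMember {V : Type} (E : V → V → Prop) (l : List V) : Prop :=
  IsDirCycleList E l ∨
    (l ≠ [] ∧ l.length ≤ 2 ∧ l.Nodup ∧ l.Chain' (fun a b => E a b ∨ E b a))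

/-- The cycle partition number `cp(D)` of the digraph `E`. -/
noncomputable def cpNum {V : Type} (E : V → V → Prop) : ℕ :=
  sInf {k | ∃ P : Finset (List V), P.card = k ∧
    (∀ l ∈ P, IsCyclePartMember E l) ∧
    (∀ v : V, ∃ l ∈ P, v ∈ l) ∧
    ∀ l ∈ P, ∀ l' ∈ P, l ≠ l' → ∀ v ∈ l, v ∉ l'}

/-- `v : Fin m → V` enumerates an induced path of the simple graph `G`. -/
def IsInducedPathEmb {V : Type} (G : SimpleGraph V) {m : ℕ} (v : Fin m → V) : Prop :=
  Function.Injective v ∧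
    ∀ i j : Fin m, G.Adj (v i) (v j) ↔ (i.val + 1 = j.val ∨ j.val + 1 = i.val)

/-- `w : Fin m → V` enumerates an induced pseudo-path of the digraph `E`:
the induced subdigraph on its image has a path as underlying graph. -/
def IsInducedPsPath {V : Type} (E : V → V → Prop) {m : ℕ} (w : Fin m → V) : Prop :=
  Function.Injective w ∧
    ∀ i j : Fin m, (E (w i) (w j) ∨ E (w j) (w i)) ↔ (i.val + 1 = j.val ∨ j.val + 1 = i.val)

/-- `r(P)` for a pseudo-path enumerated by `w`: the number of (internal) vertices
having out-degree 2 or in-degree 2 in the pseudo-path. -/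
noncomputable def turnCount {V : Type} (E : V → V → Prop) {m : ℕ} (w : Fin m → V) : ℕ :=
  Set.ncard {i : Fin m | ∃ j k : Fin m, j.val + 1 = i.val ∧ i.val + 1 = k.val ∧
    ((E (w i) (w j) ∧ E (w i) (w k)) ∨ (E (w j) (w i) ∧ E (w k) (w i)))}

/-- Condition (D1): the underlying graph of `E` is `{K*_n, K_{1,n}, F^(1)_n, F^(2)_n}`-free. -/
def CondD1 {V : Type} (n : ℕ) (E : V → V → Prop) : Prop :=
  ¬ HasInducedCopyG (KStarG n) (SimpleGraph.fromRel E) ∧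
  ¬ HasInducedCopyG (StarG n) (SimpleGraph.fromRel E) ∧
  ¬ HasInducedCopyG (F1G n) (SimpleGraph.fromRel E) ∧
  ¬ HasInducedCopyG (F2G n) (SimpleGraph.fromRel E)

/-- Condition (D'1): the underlying graph of `E` is
`{K*_n, K_{1,n}, F^(1)_n, F^(2)_n, F^(3)_n, F^(4)_n}`-free. -/
def CondD1' {V : Type} (n : ℕ) (E : V → V → Prop) : Prop :=
  CondD1 n E ∧
  ¬ HasInducedCopyG (F3G n) (SimpleGraph.fromRel E) ∧
  ¬ HasInducedCopyG (F4G n) (SimpleGraph.fromRel E)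

/-- Condition (D2): `E` is `{D^(1)_n, D^(2)_n, D^(3)_n}`-free. -/
def CondD2 {V : Type} (n : ℕ) (E : V → V → Prop) : Prop :=
  ¬ DigraphHasInducedCopy (D1Rel n) E ∧
  ¬ DigraphHasInducedCopy (D2Rel n) E ∧
  ¬ DigraphHasInducedCopy (D3Rel n) E

/-- Condition (D3): `r(P) ≤ n` for every induced pseudo-path `P` of `E`. -/
def CondD3 {V : Type} (n : ℕ) (E : V → V → Prop) : Prop :=
  ∀ (m : ℕ) (w : Fin m → V), IsInducedPsPath E w → turnCount E w ≤ n

/-- The Ramsey number `R(a, b)`: the least `R` such that every graph on at least `R`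
vertices contains a clique of size `a` or an independent set of size `b`. -/
noncomputable def ramseyNumber (a b : ℕ) : ℕ :=
  sInf {R | ∀ m : ℕ, R ≤ m → ∀ G : SimpleGraph (Fin m),
    (∃ s : Finset (Fin m), G.IsNClique a s) ∨ (∃ s : Finset (Fin m), Gᶜ.IsNClique b s)}

/-- The independence number of the subgraph of `G` induced by `X`. -/
noncomputable def indepNumOn {V : Type} (G : SimpleGraph V) (X : Set V) : ℕ :=
  sSup {k | ∃ s : Finset V, ↑s ⊆ X ∧ s.card = k ∧ ∀ a ∈ s, ∀ b ∈ s, a ≠ b → ¬ G.Adj a b}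

/-- The independence number `α(G)`. -/
noncomputable def indepNum {V : Type} (G : SimpleGraph V) : ℕ := indepNumOn G Set.univ

/-- The neighborhood `N_G(X)` of a set of vertices. -/
def nbhd {V : Type} (G : SimpleGraph V) (X : Set V) : Set V :=
  {v | v ∉ X ∧ ∃ x ∈ X, G.Adj v x}

namespace PathCover

open SimpleGraph

variable {V : Type} {G : SimpleGraph V}

/-! ### Ramsey's theorem and independence bounds -/

theorem exists_isNClique_or_isNIndepSet (a b : ℕ) :
    ∃ R : ℕ, ∀ {V : Type} (G : SimpleGraph V) (X : Finset V), R ≤ X.card →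
      (∃ K ⊆ X, G.IsNClique a K) ∨ ∃ I ⊆ X, G.IsNIndepSet b I := by
  classical
  induction a generalizing b with
  | zero => exact ⟨0, fun G X _ => Or.inl ⟨∅, by simp, by simp [isNClique_iff]⟩⟩
  | succ a iha =>
    induction b with
    | zero => exact ⟨0, fun G X _ => Or.inr ⟨∅, by simp, by simp [isNIndepSet_iff]⟩⟩
    | succ b ihb =>
      obtain ⟨R₁, h₁⟩ := iha (b + 1)
      obtain ⟨R₂, h₂⟩ := ihb
      refine ⟨R₁ + R₂ + 1, fun {V} G X hX => ?_⟩
      obtain ⟨x, hx⟩ : X.Nonempty := Finset.card_pos.mp (by omega)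
      have hcard := Finset.card_filter_add_card_filter_not (s := X.erase x) (fun y => G.Adj x y)
      rw [Finset.card_erase_of_mem hx] at hcard
      by_cases hN : R₁ ≤ ((X.erase x).filter fun y => G.Adj x y).card
      · obtain ⟨K, hKX, hK⟩ | ⟨I, hIX, hI⟩ := h₁ G _ hN
        · refine Or.inl ⟨insert x K, ?_, hK.insert fun y hy => (Finset.mem_filter.mp (hKX hy)).2⟩
          intro y hy
          obtain rfl | hy := Finset.mem_insert.mp hy
          · exact hx
          · exact Finset.mem_of_mem_erase (Finset.mem_filter.mp (hKX hy)).1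
        · exact Or.inr ⟨I, fun y hy =>
            Finset.mem_of_mem_erase (Finset.mem_filter.mp (hIX hy)).1, hI⟩
      · obtain ⟨K, hKX, hK⟩ | ⟨I, hIX, hI⟩ :=
          h₂ G ((X.erase x).filter fun y => ¬ G.Adj x y) (by omega)
        · exact Or.inl ⟨K, fun y hy =>
            Finset.mem_of_mem_erase (Finset.mem_filter.mp (hKX hy)).1, hK⟩
        · refine Or.inr ⟨insert x I, ?_, ?_⟩
          · intro y hy
            obtain rfl | hy := Finset.mem_insert.mp hy
            · exact hx
            · exact Finset.mem_of_mem_erase (Finset.mem_filter.mp (hIX hy)).1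
          · rw [← isNClique_compl] at hI ⊢
            refine hI.insert fun y hy => ?_
            have := Finset.mem_filter.mp (hIX hy)
            rw [compl_adj]
            exact ⟨(Finset.ne_of_mem_erase this.1).symm, this.2⟩

/-- Every independent set contained in `S` has at most `k` elements. -/
def IndepBound (G : SimpleGraph V) (S : Set V) (k : ℕ) : Prop :=
  ∀ I : Finset V, (I : Set V) ⊆ S → G.IsIndepSet I → I.card ≤ k

theorem IndepBound.mono {S T : Set V} {k : ℕ} (h : IndepBound G T k) (hST : S ⊆ T) :
    IndepBound G S k :=
  fun I hI => h I (hI.trans hST)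

theorem indepBound_neighborSet {n : ℕ} (hS : ¬ HasInducedCopyG (StarG n) G) (x : V) :
    IndepBound G (G.neighborSet x) n := by
  intro I hI hind
  by_contra! hlt
  let e : Fin n → I := fun i => I.equivFin.symm ⟨i, by omega⟩
  have he : Function.Injective fun i => (e i : V) := by
    intro i j hij
    have := I.equivFin.symm.injective (Subtype.ext hij)
    simpa [Fin.ext_iff] using this
  have hadj : ∀ i, G.Adj x (e i) := fun i => hI (e i).2
  refine hS ⟨Sum.elim (fun _ => x) fun i => e i, ?_, ?_⟩
  · refine Function.Injective.sumElim (fun _ _ _ => rfl) he fun _ i h => ?_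
    exact (hadj i).ne h
  · rintro (a | i) (b | j)
    · simp [StarG]
    · simp [StarG, hadj]
    · simp [StarG, (hadj _).symm]
    · simp only [Sum.elim_inr, StarG, fromRel_adj, or_self, and_false, iff_false]
      intro h
      exact hind (e i).2 (e j).2 h.ne h

theorem exists_adj_dist_eq (hG : G.Connected) {r v : V} {d : ℕ} (h : G.dist r v = d + 1) :
    ∃ u, G.Adj u v ∧ G.dist r u = d := by
  obtain ⟨w, hw⟩ := hG.exists_walk_length_eq_dist v r
  cases w with
  | nil => simp at h
  | cons hadj w =>
    rename_i u
    refine ⟨u, hadj.symm, ?_⟩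
    rw [dist_comm, h, Walk.length_cons] at hw
    have h₁ := dist_le w
    have h₂ := hG.dist_triangle (u := r) (v := u) (w := v)
    rw [dist_eq_one_iff_adj.mpr hadj.symm] at h₂
    rw [dist_comm] at h₁
    omega

/-- A clique `X` each of whose vertices has a private neighbour in an independent set. -/
theorem hasInducedCopyG_kStarG {n : ℕ} {X : Finset V} (hX : G.IsNClique n X) (y : V → V)
    (hyX : ∀ x ∈ X, y x ∉ X) (hadj : ∀ x ∈ X, ∀ x' ∈ X, G.Adj x' (y x) ↔ x' = x)
    (hy : ∀ x ∈ X, ∀ x' ∈ X, ¬ G.Adj (y x) (y x')) : HasInducedCopyG (KStarG n) G := by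
  let e : Fin n → X := fun i => X.equivFin.symm ⟨i, by rw [hX.card_eq]; exact i.2⟩
  have he : ∀ i j, (e i : V) = e j ↔ i = j := by
    intro i j
    rw [← Subtype.ext_iff, X.equivFin.symm.injective.eq_iff]
    simp [Fin.ext_iff]
  refine ⟨Sum.elim (fun i => e i) fun i => y (e i), ?_, ?_⟩
  · refine Function.Injective.sumElim (fun i j h => (he i j).mp h) (fun i j h => ?_) ?_
    · have := (hadj _ (e i).2 _ (e i).2).mpr rfl
      rw [show y (e i) = y (e j) from h] at this
      exact (he i j).mp ((hadj _ (e j).2 _ (e i).2).mp this)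
    · intro i j h
      exact hyX _ (e j).2 (h ▸ (e i).2)
  · rintro (i | i) (j | j)
    · simp only [Sum.elim_inl, KStarG, fromRel_adj]
      constructor
      · intro h
        have : i ≠ j := fun hij => h.ne (by rw [hij])
        exact ⟨by simpa using this, Or.inl this⟩
      · rintro ⟨h, -⟩
        refine hX.isClique (e i).2 (e j).2 fun h' => h ?_
        rw [(he i j).mp h']
    · simp only [Sum.elim_inl, Sum.elim_inr, KStarG, fromRel_adj]
      rw [hadj _ (e j).2 _ (e i).2, he]
      simp
    · simp only [Sum.elim_inl, Sum.elim_inr, KStarG, fromRel_adj]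
      rw [G.adj_comm, hadj _ (e i).2 _ (e j).2, he]
      simp
    · simp only [Sum.elim_inr, KStarG, fromRel_adj]
      simpa using hy _ (e i).2 _ (e j).2

/-- Balls of bounded radius have bounded independence number. -/
theorem exists_indepBound_ball (n d : ℕ) :
    ∃ k, ∀ {V : Type} (G : SimpleGraph V), G.Connected →
      ¬ HasInducedCopyG (KStarG n) G → ¬ HasInducedCopyG (StarG n) G →
      ∀ r, IndepBound G {v | G.dist r v ≤ d} k := by
  classical
  induction d with
  | zero =>
    refine ⟨1, fun G hG _ _ r I hI _ => Finset.card_le_one.mpr fun a ha b hb => ?_⟩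
    have key : ∀ v ∈ I, r = v := fun v hv => by
      have : G.dist r v ≤ 0 := hI hv
      exact hG.dist_eq_zero_iff.mp (by omega)
    rw [← key a ha, ← key b hb]
  | succ d ih =>
    obtain ⟨k, hk⟩ := ih
    obtain ⟨R, hR⟩ := exists_isNClique_or_isNIndepSet n (k + 1)
    refine ⟨k + R * n, fun {V} G hG hK hS r I hI hind => ?_⟩
    let J := I.filter fun v => ¬ G.dist r v ≤ d
    have hJd : ∀ v ∈ J, G.dist r v = d + 1 := fun v hv => by
      have h₁ := (Finset.mem_filter.mp hv).2
      have h₂ : G.dist r v ≤ d + 1 := hI (Finset.mem_filter.mp hv).1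
      omega
    have hIJ : (I.filter fun v => G.dist r v ≤ d).card ≤ k :=
      hk G hG hK hS r _ (fun v hv => (Finset.mem_filter.mp hv).2)
        (hind.mono fun v hv => (Finset.mem_filter.mp hv).1)
    have hcard : (I.filter fun v => G.dist r v ≤ d).card + J.card = I.card :=
      Finset.card_filter_add_card_filter_not _
    choose! par hpar hpard using fun v (hv : v ∈ J) => exists_adj_dist_eq hG (hJd v hv)
    obtain ⟨X, -, hX⟩ := exists_minimal_le_of_wellFoundedLT
      (fun X : Finset V => (∀ x ∈ X, G.dist r x ≤ d) ∧ ∀ v ∈ J, ∃ x ∈ X, G.Adj x v) (J.image par)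
      ⟨fun x hx => by
        obtain ⟨v, hv, rfl⟩ := Finset.mem_image.mp hx
        exact (hpard v hv).le,
       fun v hv => ⟨par v, Finset.mem_image_of_mem _ hv, hpar v hv⟩⟩
    have hpriv : ∀ x ∈ X, ∃ v ∈ J, ∀ x' ∈ X, G.Adj x' v ↔ x' = x := by
      intro x hx
      by_contra! hcon
      have hnot := hX.not_prop_of_lt (Finset.erase_ssubset hx)
      refine hnot ⟨fun x' hx' => hX.prop.1 x' (Finset.mem_of_mem_erase hx'), fun v hv => ?_⟩
      obtain ⟨x₁, hx₁, h₁⟩ := hcon v hv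
      obtain ⟨x₂, hx₂, h₂⟩ := hX.prop.2 v hv
      rcases h₁ with ⟨h₁, hne⟩ | ⟨h₁, rfl⟩
      · exact ⟨x₁, Finset.mem_erase.mpr ⟨hne, hx₁⟩, h₁⟩
      · refine ⟨x₂, Finset.mem_erase.mpr ⟨?_, hx₂⟩, h₂⟩
        rintro rfl
        exact h₁ h₂
    choose! y hyJ hy using hpriv
    have hXR : X.card ≤ R := by
      by_contra! hlt
      obtain ⟨K, hKX, hKc⟩ | ⟨A, hAX, hA⟩ := hR G X hlt.le
      · refine hK (hasInducedCopyG_kStarG hKc y (fun x hx hyK => ?_)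
          (fun x hx x' hx' => hy x (hKX hx) x' (hKX hx')) fun x hx x' hx' hadj => ?_)
        · have h₁ := hX.prop.1 _ (hKX hyK)
          have h₂ := hJd _ (hyJ x (hKX hx))
          omega
        · exact hind (Finset.mem_filter.mp (hyJ x (hKX hx))).1
            (Finset.mem_filter.mp (hyJ x' (hKX hx'))).1 hadj.ne hadj
      · have := hk G hG hK hS r A (fun a ha => hX.prop.1 a (hAX ha)) hA.isIndepSet
        rw [hA.card_eq] at this
        omega
    have hJX : J.card ≤ X.card * n := by
      have hsub : J ⊆ X.biUnion fun x => J.filter fun v => G.Adj x v := fun v hv => by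
        obtain ⟨x, hx, hxv⟩ := hX.prop.2 v hv
        exact Finset.mem_biUnion.mpr ⟨x, hx, Finset.mem_filter.mpr ⟨hv, hxv⟩⟩
      refine (Finset.card_le_card hsub).trans (Finset.card_biUnion_le_card_mul _ _ _ fun x _ => ?_)
      refine indepBound_neighborSet hS x _ (fun v hv => (Finset.mem_filter.mp hv).2) ?_
      exact hind.mono fun v hv => (Finset.mem_filter.mp (Finset.mem_filter.mp hv).1).1
    have := Nat.mul_le_mul_right n hXR
    omega

/-! ### Covering vertex sets by paths -/

/-- A set whose independent subsets have at most `k` elements is covered by `k` paths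
inside it (some of which may be empty). -/
theorem IndepBound.exists_paths [Finite V] {S : Set V} {k : ℕ} (h : IndepBound G S k) :
    ∃ R : ℕ → List V, (∀ i, (R i).Nodup ∧ (R i).IsChain G.Adj ∧ ∀ v ∈ R i, v ∈ S) ∧
      ∀ v ∈ S, ∃ i < k, v ∈ R i := by
  classical
  have := Fintype.ofFinite V
  induction k generalizing S with
  | zero =>
    refine ⟨fun _ => [], by simp, fun v hv => ?_⟩
    have := h {v} (by simpa using hv) (by simp)
    simp at this
  | succ k ih =>
    obtain rfl | ⟨s, hs⟩ := S.eq_empty_or_nonempty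
    · exact ⟨fun _ => [], by simp, by simp⟩
    let N : Set ℕ :=
      {m | ∃ l : List V, (l.Nodup ∧ l.IsChain G.Adj ∧ ∀ v ∈ l, v ∈ S) ∧ l.length = m}
    have hbdd : BddAbove N := by
      refine ⟨Fintype.card V, ?_⟩
      rintro _ ⟨l, hl, rfl⟩
      exact hl.1.length_le_card
    have hne : N.Nonempty := ⟨1, [s], by simpa using hs, rfl⟩
    obtain ⟨l, ⟨hnd, hch, hlS⟩, hlen⟩ := Nat.sSup_mem hne hbdd
    have hpos : 1 ≤ l.length := hlen ▸ le_csSup hbdd ⟨[s], by simpa using hs, rfl⟩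
    obtain ⟨a, t, rfl⟩ := List.exists_cons_of_length_pos hpos
    have hmax : ∀ v ∈ S, G.Adj v a → v ∈ a :: t := by
      intro v hv hva
      by_contra hmem
      have : (v :: a :: t).length ≤ (a :: t).length := hlen ▸ le_csSup hbdd
        ⟨v :: a :: t, ⟨List.nodup_cons.mpr ⟨hmem, hnd⟩, List.isChain_cons_cons.mpr ⟨hva, hch⟩,
          by simpa [hv] using hlS⟩, rfl⟩
      simp at this
    obtain ⟨R, hR, hcov⟩ := ih (S := {v ∈ S | v ∉ a :: t}) fun I hI hind => by
      have haI : a ∉ I := fun ha => (hI ha).2 (by simp)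
      have := h (insert a I) ?_ ?_
      · rw [Finset.card_insert_of_notMem haI] at this
        omega
      · rw [Finset.coe_insert]
        exact Set.insert_subset (hlS a (by simp)) fun v hv => (hI hv).1
      · rw [Finset.coe_insert]
        refine Set.pairwise_insert.mpr ⟨hind, fun v hv _ => ?_⟩
        have hva : ¬ G.Adj v a := fun hva => (hI hv).2 (hmax v (hI hv).1 hva)
        exact ⟨fun hav => hva hav.symm, hva⟩
    refine ⟨fun i => Nat.casesOn i (a :: t) R, fun i => ?_, fun v hv => ?_⟩
    · cases i with
      | zero => exact ⟨hnd, hch, hlS⟩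
      | succ i => exact ⟨(hR i).1, (hR i).2.1, fun v hv => ((hR i).2.2 v hv).1⟩
    · by_cases hvl : v ∈ a :: t
      · exact ⟨0, by omega, hvl⟩
      · obtain ⟨i, hi, hvi⟩ := hcov v ⟨hv, hvl⟩
        exact ⟨i + 1, by omega, hvi⟩

/-- `S` is covered by at most `k` paths of `G`. -/
def CoveredBy (G : SimpleGraph V) (S : Set V) (k : ℕ) : Prop :=
  ∃ F : Finset (List V), F.card ≤ k ∧ (∀ l ∈ F, IsPathList G l) ∧ ∀ v ∈ S, ∃ l ∈ F, v ∈ l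

theorem CoveredBy.pcG_le {k : ℕ} (h : CoveredBy G Set.univ k) : pcG G ≤ k := by
  obtain ⟨F, hF, hpath, hcov⟩ := h
  have : F.card ∈ {k | ∃ P : Finset (List V), P.card = k ∧
      (∀ l ∈ P, IsPathList G l) ∧ ∀ v : V, ∃ l ∈ P, v ∈ l} :=
    ⟨F, rfl, hpath, fun v => hcov v trivial⟩
  exact (Nat.sInf_le this).trans hF

theorem CoveredBy.mono {S T : Set V} {k : ℕ} (h : CoveredBy G T k) (hST : S ⊆ T) :
    CoveredBy G S k :=
  let ⟨F, hF, hpath, hcov⟩ := h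
  ⟨F, hF, hpath, fun v hv => hcov v (hST hv)⟩

theorem CoveredBy.biUnion {ι : Type} (M : Finset ι) {S : ι → Set V} {k : ℕ}
    (h : ∀ i ∈ M, CoveredBy G (S i) k) : CoveredBy G (⋃ i ∈ M, S i) (M.card * k) := by
  classical
  choose! F hF hpath hcov using h
  refine ⟨M.biUnion F, Finset.card_biUnion_le_card_mul _ _ _ hF, fun l hl => ?_, fun v hv => ?_⟩
  · obtain ⟨i, hi, hl⟩ := Finset.mem_biUnion.mp hl
    exact hpath i hi l hl
  · obtain ⟨i, hi, hv⟩ := Set.mem_iUnion₂.mp hv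
    obtain ⟨l, hl, hvl⟩ := hcov i hi v hv
    exact ⟨l, Finset.mem_biUnion.mpr ⟨i, hi, hl⟩, hvl⟩

theorem CoveredBy.union {S T : Set V} {k m : ℕ} (hS : CoveredBy G S k) (hT : CoveredBy G T m) :
    CoveredBy G (S ∪ T) (k + m) := by
  classical
  obtain ⟨F, hF, hpath, hcov⟩ := hS
  obtain ⟨F', hF', hpath', hcov'⟩ := hT
  refine ⟨F ∪ F', (Finset.card_union_le _ _).trans (by omega), fun l hl => ?_, ?_⟩
  · exact (Finset.mem_union.mp hl).elim (hpath l) (hpath' l)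
  · rintro v (hv | hv)
    · obtain ⟨l, hl, hvl⟩ := hcov v hv
      exact ⟨l, Finset.mem_union_left _ hl, hvl⟩
    · obtain ⟨l, hl, hvl⟩ := hcov' v hv
      exact ⟨l, Finset.mem_union_right _ hl, hvl⟩

theorem coveredBy_of_list {l : List V} (hnd : l.Nodup) (hch : l.IsChain G.Adj) :
    CoveredBy G {v | v ∈ l} 1 := by
  obtain rfl | hl := eq_or_ne l []
  · exact ⟨∅, by simp, by simp, by simp⟩
  · refine ⟨{l}, by simp, ?_, by simp⟩
    simpa using ⟨hl, hnd, hch⟩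

theorem IndepBound.coveredBy [Finite V] {S : Set V} {k : ℕ} (h : IndepBound G S k) :
    CoveredBy G S k := by
  obtain ⟨R, hR, hcov⟩ := h.exists_paths
  have := CoveredBy.biUnion (G := G) (Finset.range k) (S := fun i => {v | v ∈ R i})
    fun i _ => coveredBy_of_list (hR i).1 (hR i).2.1
  rw [Finset.card_range, mul_one] at this
  refine this.mono fun v hv => ?_
  obtain ⟨i, hi, hvi⟩ := hcov v hv
  exact Set.mem_iUnion₂.mpr ⟨i, Finset.mem_range.mpr hi, hvi⟩

/-! ### Forks along geodesics -/

/-- `p 0, …, p h` is a geodesic of `G` starting at `r`. -/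
structure IsGeodesic (G : SimpleGraph V) (r : V) (h : ℕ) (p : ℕ → V) : Prop where
  adj : ∀ i < h, G.Adj (p i) (p (i + 1))
  dist : ∀ i ≤ h, G.dist r (p i) = i

theorem dist_le_dist_add_one (hG : G.Connected) (r : V) {u v : V} (h : G.Adj u v) :
    G.dist r v ≤ G.dist r u + 1 := by
  have := hG.dist_triangle (u := r) (v := u) (w := v)
  rwa [dist_eq_one_iff_adj.mpr h] at this

theorem exists_isGeodesic (hG : G.Connected) (r v : V) :
    ∃ p, IsGeodesic G r (G.dist r v) p ∧ p (G.dist r v) = v := by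
  generalize hd : G.dist r v = d
  induction d generalizing v with
  | zero =>
    refine ⟨fun _ => v, ⟨by omega, fun i hi => ?_⟩, rfl⟩
    rw [hd]
    omega
  | succ d ih =>
    obtain ⟨u, huv, hu⟩ := exists_adj_dist_eq hG hd
    obtain ⟨p, hp, hpu⟩ := ih u hu
    refine ⟨fun i => if i = d + 1 then v else p i, ⟨fun i hi => ?_, fun i hi => ?_⟩, by simp⟩
    · obtain rfl | hne := eq_or_ne i d
      · simpa [hpu] using huv
      · simpa [hne, show i ≠ d + 1 by omega] using hp.adj i (by omega)
    · obtain rfl | hne := eq_or_ne i (d + 1)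
      · simpa using hd
      · simpa [hne] using hp.dist i (by omega)

namespace IsGeodesic

variable {r : V} {h : ℕ} {p : ℕ → V}

theorem eq_iff (hp : IsGeodesic G r h p) {i j : ℕ} (hi : i ≤ h) (hj : j ≤ h) :
    p i = p j ↔ i = j := by
  refine ⟨fun hij => ?_, fun hij => by rw [hij]⟩
  rw [← hp.dist i hi, hij, hp.dist j hj]

theorem adj_iff (hG : G.Connected) (hp : IsGeodesic G r h p) {i j : ℕ} (hi : i ≤ h) (hj : j ≤ h) :
    G.Adj (p i) (p j) ↔ i + 1 = j ∨ j + 1 = i := by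
  constructor
  · intro hadj
    have h₁ := dist_le_dist_add_one hG r hadj
    have h₂ := dist_le_dist_add_one hG r hadj.symm
    have h₃ : i ≠ j := fun hij => hadj.ne (by rw [hij])
    rw [hp.dist i hi, hp.dist j hj] at h₁ h₂
    omega
  · rintro (rfl | rfl)
    · exact hp.adj i (by omega)
    · exact (hp.adj j (by omega)).symm

theorem dist_add_le (hG : G.Connected) (hp : IsGeodesic G r h p) {i k : ℕ} (hk : i + k ≤ h) :
    G.dist (p i) (p (i + k)) ≤ k := by
  induction k with
  | zero => simp
  | succ k ih =>
    have := dist_le_dist_add_one hG (p i) (hp.adj (i + k) (by omega))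
    have := ih (by omega)
    rw [← add_assoc]
    omega

end IsGeodesic

/-- Sufficient conditions for a fork with two long arms `y`, `z` and a short arm `x₂` at `x₁`. -/
theorem hasInducedCopyG_F1G_or_F2G {n : ℕ} {x₁ x₂ : V} {y z : ℕ → V} {c : Prop}
    (hx : G.Adj x₁ x₂)
    (hx₁y : ∀ i < n, x₁ ≠ y i ∧ (G.Adj x₁ (y i) ↔ i = 0))
    (hx₁z : ∀ i < n, x₁ ≠ z i ∧ (G.Adj x₁ (z i) ↔ i = 0))
    (hx₂y : ∀ i < n, x₂ ≠ y i ∧ ¬ G.Adj x₂ (y i))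
    (hx₂z : ∀ i < n, x₂ ≠ z i ∧ ¬ G.Adj x₂ (z i))
    (hy : ∀ i < n, ∀ j < n, (y i = y j → i = j) ∧ (G.Adj (y i) (y j) ↔ i + 1 = j ∨ j + 1 = i))
    (hz : ∀ i < n, ∀ j < n, (z i = z j → i = j) ∧ (G.Adj (z i) (z j) ↔ i + 1 = j ∨ j + 1 = i))
    (hyz : ∀ i < n, ∀ j < n, y i ≠ z j ∧ (G.Adj (y i) (z j) ↔ c ∧ i = 0 ∧ j = 0)) :
    (¬ c → HasInducedCopyG (F1G n) G) ∧ (c → HasInducedCopyG (F2G n) G) := by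
  let f : Fin 2 ⊕ Fin n ⊕ Fin n → V :=
    Sum.elim ![x₁, x₂] (Sum.elim (fun i => y i) fun i => z i)
  have hinj : Function.Injective f := by
    refine Function.Injective.sumElim ?_ (Function.Injective.sumElim ?_ ?_ ?_) ?_
    · intro i j hij
      fin_cases i <;> fin_cases j <;> simp_all [hx.ne, hx.ne']
    · exact fun i j hij => Fin.ext ((hy i i.2 j j.2).1 hij)
    · exact fun i j hij => Fin.ext ((hz i i.2 j j.2).1 hij)
    · exact fun i j => (hyz i i.2 j j.2).1
    · rintro i (j | j)
      · fin_cases i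
        · exact (hx₁y j j.2).1
        · exact (hx₂y j j.2).1
      · fin_cases i
        · exact (hx₁z j j.2).1
        · exact (hx₂z j j.2).1
  have hzy : ∀ i : Fin n, ∀ j : Fin n, G.Adj (z i) (y j) ↔ c ∧ (j : ℕ) = 0 ∧ (i : ℕ) = 0 :=
    fun i j => by rw [G.adj_comm, (hyz j j.2 i i.2).2]
  have hxs := hx.symm
  refine ⟨fun hc => ⟨f, hinj, ?_⟩, fun hc => ⟨f, hinj, ?_⟩⟩
  · rintro (i | i | i) (j | j | j)
    · fin_cases i <;> fin_cases j <;> simp [f, F1G, hx, hxs]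
    · fin_cases i <;> simp [f, F1G, (hx₁y j j.2).2, (hx₂y j j.2).2]
    · fin_cases i <;> simp [f, F1G, (hx₁z j j.2).2, (hx₂z j j.2).2]
    · fin_cases j <;> simp [f, F1G, G.adj_comm (y i), (hx₁y i i.2).2, (hx₂y i i.2).2]
    · simp [f, F1G, (hy i i.2 j j.2).2]
      omega
    · simp [f, F1G, (hyz i i.2 j j.2).2, hc]
    · fin_cases j <;> simp [f, F1G, G.adj_comm (z i), (hx₁z i i.2).2, (hx₂z i i.2).2]
    · simp [f, F1G, hzy, hc]
    · simp [f, F1G, (hz i i.2 j j.2).2]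
      omega
  · rintro (i | i | i) (j | j | j)
    · fin_cases i <;> fin_cases j <;> simp [f, F2G, F1G, YZEdgeG, hx, hxs]
    · fin_cases i <;> simp [f, F2G, F1G, YZEdgeG, (hx₁y j j.2).2, (hx₂y j j.2).2]
    · fin_cases i <;> simp [f, F2G, F1G, YZEdgeG, (hx₁z j j.2).2, (hx₂z j j.2).2]
    · fin_cases j <;>
        simp [f, F2G, F1G, YZEdgeG, G.adj_comm (y i), (hx₁y i i.2).2, (hx₂y i i.2).2]
    · simp [f, F2G, F1G, YZEdgeG, (hy i i.2 j j.2).2]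
      omega
    · simp [f, F2G, F1G, YZEdgeG, (hyz i i.2 j j.2).2, hc]
    · fin_cases j <;>
        simp [f, F2G, F1G, YZEdgeG, G.adj_comm (z i), (hx₁z i i.2).2, (hx₂z i i.2).2]
    · simp [f, F2G, F1G, YZEdgeG, hzy, hc]
    · simp [f, F2G, F1G, YZEdgeG, (hz i i.2 j j.2).2]
      omega

namespace IsGeodesic

variable {r : V} {h : ℕ} {p : ℕ → V}

/-- A fork whose long arms are the two directions of a geodesic, starting at `p b` and `p a`. -/
theorem hasInducedCopyG_fork (hG : G.Connected) (hp : IsGeodesic G r h p) {n a b : ℕ}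
    (hab : a < b) (ha : n ≤ a + 1) (hb : b + n ≤ h + 1) {x₁ x₂ : V} (hx : G.Adj x₁ x₂)
    (hx₁ : ∀ i ≤ h, i ≤ a ∨ b ≤ i → x₁ ≠ p i ∧ (G.Adj x₁ (p i) ↔ i = a ∨ i = b))
    (hx₂ : ∀ i ≤ h, i ≤ a ∨ b ≤ i → x₂ ≠ p i ∧ ¬ G.Adj x₂ (p i)) :
    (a + 1 ≠ b → HasInducedCopyG (F1G n) G) ∧ (a + 1 = b → HasInducedCopyG (F2G n) G) := by
  refine hasInducedCopyG_F1G_or_F2G (y := fun i => p (b + i)) (z := fun i => p (a - i)) hx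
    ?_ ?_ ?_ ?_ ?_ ?_ ?_
  · intro i hi
    obtain ⟨h₁, h₂⟩ := hx₁ (b + i) (by omega) (by omega)
    exact ⟨h₁, h₂.trans (by omega)⟩
  · intro i hi
    obtain ⟨h₁, h₂⟩ := hx₁ (a - i) (by omega) (by omega)
    exact ⟨h₁, h₂.trans (by omega)⟩
  · exact fun i hi => hx₂ (b + i) (by omega) (by omega)
  · exact fun i hi => hx₂ (a - i) (by omega) (by omega)
  · intro i hi j hj
    rw [hp.eq_iff (by omega) (by omega), hp.adj_iff hG (by omega) (by omega)]
    omega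
  · intro i hi j hj
    rw [hp.eq_iff (by omega) (by omega), hp.adj_iff hG (by omega) (by omega)]
    omega
  · intro i hi j hj
    rw [Ne, hp.eq_iff (by omega) (by omega), hp.adj_iff hG (by omega) (by omega)]
    omega

/-- A vertex `w` off a geodesic but adjacent to its middle part has two neighbours on it at
distance at most two, and every neighbour of `w` is on the geodesic or adjacent to it. -/
theorem of_adj_middle (hG : G.Connected) (hp : IsGeodesic G r h p) {n : ℕ} (hn : 0 < n)
    (hF₁ : ¬ HasInducedCopyG (F1G n) G) (hF₂ : ¬ HasInducedCopyG (F2G n) G) {w : V}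
    (hw : ∀ i ≤ h, w ≠ p i) {m : ℕ} (hwm : G.Adj w (p m)) (hm : n + 2 ≤ m) (hmh : m + n + 2 ≤ h) :
    (∃ a, a + 2 ≤ h ∧ G.Adj w (p a) ∧ (G.Adj w (p (a + 1)) ∨ G.Adj w (p (a + 2)))) ∧
    ∀ x, G.Adj w x → ∃ i ≤ h, x = p i ∨ G.Adj x (p i) := by
  classical
  have hwin : ∀ i ≤ h, ∀ j ≤ h, G.Adj w (p i) → G.Adj w (p j) → j ≤ i + 2 := by
    intro i hi j hj hwi hwj
    have h₁ := dist_le_dist_add_one hG r hwi.symm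
    have h₂ := dist_le_dist_add_one hG r hwj
    rw [hp.dist i hi] at h₁
    rw [hp.dist j hj] at h₂
    omega
  have hfirst : ∃ i, G.Adj w (p i) := ⟨m, hwm⟩
  have ham : Nat.find hfirst ≤ m := Nat.find_min' hfirst hwm
  have hwa : G.Adj w (p (Nat.find hfirst)) := Nat.find_spec hfirst
  have hmin : ∀ i < Nat.find hfirst, ¬ G.Adj w (p i) := fun i hi => Nat.find_min hfirst hi
  generalize Nat.find hfirst = a at ham hwa hmin
  have ha := hwin a (by omega) m (by omega) hwa hwm
  obtain ⟨b, hb, hwb, hmax⟩ : ∃ b ≤ h, G.Adj w (p b) ∧ ∀ i ≤ h, b < i → ¬ G.Adj w (p i) := by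
    have hspec := Nat.findGreatest_spec (P := fun i => G.Adj w (p i)) (n := h) (by omega) hwm
    exact ⟨_, Nat.findGreatest_le h, hspec, fun i hi hlt => Nat.findGreatest_is_greatest hlt hi⟩
  have hba := hwin a (by omega) b hb hwa hwb
  have hab : a ≤ b := by
    by_contra! hlt
    exact hmin b hlt hwb
  obtain rfl | hab := hab.eq_or_lt
  · refine absurd ((hp.hasInducedCopyG_fork hG (n := n) (a := a - 1) (b := a + 1) (by omega)
      (by omega) (by omega) hwa.symm ?_ ?_).1 (by omega)) hF₁
    · intro i hi hia
      rw [Ne, hp.eq_iff (by omega) hi, hp.adj_iff hG (by omega) hi]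
      omega
    · intro i hi hia
      refine ⟨hw i hi, ?_⟩
      obtain hlt | hlt : i < a ∨ a < i := by omega
      · exact hmin i hlt
      · exact hmax i hi hlt
  refine ⟨⟨a, by omega, hwa, ?_⟩, fun x hwx => ?_⟩
  · obtain rfl | rfl : b = a + 1 ∨ b = a + 2 := by omega
    · exact Or.inl hwb
    · exact Or.inr hwb
  by_contra! hx
  have hfork := hp.hasInducedCopyG_fork hG (n := n) hab (by omega)
    (by have := hwin m (by omega) b hb hwm hwb; omega) hwx (fun i hi hia => ⟨hw i hi, ?_⟩)
    fun i hi _ => hx i hi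
  · by_cases hb' : a + 1 = b
    · exact hF₂ (hfork.2 hb')
    · exact hF₁ (hfork.1 hb')
  · constructor
    · intro hwi
      obtain hlt | hlt : i ≤ a ∨ b ≤ i := hia
      · by_contra hne
        exact hmin i (by omega) hwi
      · by_contra hne
        exact hmax i hi (by omega) hwi
    · rintro (rfl | rfl)
      · exact hwa
      · exact hwb

end IsGeodesic

/-! ### Covering the neighbourhood of a geodesic -/

namespace IsGeodesic

variable {r : V} {h : ℕ} {p : ℕ → V}

theorem coveredBy_range (hp : IsGeodesic G r h p) : CoveredBy G {v | ∃ i ≤ h, v = p i} 1 := by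
  refine (coveredBy_of_list (G := G) (l := (List.range (h + 1)).map p) ?_ ?_).mono ?_
  · refine List.Nodup.map_on (fun i hi j hj hij => ?_) List.nodup_range
    rw [List.mem_range] at hi hj
    exact (hp.eq_iff (by omega) (by omega)).mp hij
  · rw [List.isChain_iff_getElem]
    intro i hi
    simp only [List.length_map, List.length_range] at hi
    simpa using hp.adj i (by omega)
  · rintro _ ⟨i, hi, rfl⟩
    exact List.mem_map_of_mem (List.mem_range.mpr (by omega))

/-- The vertices off the geodesic adjacent to `p i` and to `p (i + 1)` or `p (i + 2)`. -/
def detour (G : SimpleGraph V) (h : ℕ) (p : ℕ → V) (i : ℕ) : Set V :=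
  {w | (∀ j ≤ h, w ≠ p j) ∧ G.Adj w (p i) ∧ (G.Adj w (p (i + 1)) ∨ G.Adj w (p (i + 2)))}

/-- A path from `p i` to `p (i + 2)` that traverses a given path through `detour G h p i`. -/
theorem exists_segment (hG : G.Connected) (hp : IsGeodesic G r h p) {i : ℕ} (hi : i + 2 ≤ h)
    {R : List V} (hnd : R.Nodup) (hch : R.IsChain G.Adj) (hR : ∀ v ∈ R, v ∈ detour G h p i) :
    ∃ l : List V, l.Nodup ∧ l.IsChain G.Adj ∧ l.head? = some (p i) ∧
      l.getLast? = some (p (i + 2)) ∧ (∀ v ∈ l, i ≤ G.dist r v ∧ G.dist r v ≤ i + 2) ∧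
      ∀ v ∈ R, v ∈ l := by
  have hd₀ := hp.dist i (by omega)
  have hd₁ := hp.dist (i + 1) (by omega)
  have hd₂ := hp.dist (i + 2) (by omega)
  have ha₀ := hp.adj i (by omega)
  have ha₁ : G.Adj (p (i + 1)) (p (i + 2)) := hp.adj (i + 1) (by omega)
  have hne₀ : p i ∉ R := fun hmem => (hR _ hmem).1 i (by omega) rfl
  have hne₁ : p (i + 1) ∉ R := fun hmem => (hR _ hmem).1 (i + 1) (by omega) rfl
  have hne₂ : p (i + 2) ∉ R := fun hmem => (hR _ hmem).1 (i + 2) (by omega) rfl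
  have hne₀₁ : p i ≠ p (i + 1) := ha₀.ne
  have hne₁₂ : p (i + 1) ≠ p (i + 2) := ha₁.ne
  have hne₀₂ : p i ≠ p (i + 2) := by
    rw [Ne, hp.eq_iff (by omega) (by omega)]
    omega
  have hdR : ∀ v ∈ R, i ≤ G.dist r v ∧ G.dist r v ≤ i + 2 := by
    intro v hv
    obtain ⟨-, h₀, h₁⟩ := hR v hv
    have h₀ := dist_le_dist_add_one hG r h₀.symm
    obtain h₁ | h₁ := h₁
    all_goals
      have h₁ := dist_le_dist_add_one hG r h₁
      omega
  have hch' : (p i :: R).IsChain G.Adj :=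
    List.isChain_cons.mpr ⟨fun y hy => (hR y (List.mem_of_mem_head? hy)).2.1.symm, hch⟩
  have hlast : (∀ x ∈ (p i :: R).getLast?, G.Adj x (p (i + 1))) ∨
      ∀ x ∈ (p i :: R).getLast?, G.Adj x (p (i + 2)) := by
    obtain rfl | ⟨R', z, rfl⟩ := R.eq_nil_or_concat'
    · simpa using Or.inl ha₀
    · rw [← List.cons_append, List.getLast?_concat]
      simpa using (hR z (by simp)).2.2
  obtain hlast | hlast := hlast
  · refine ⟨(p i :: R) ++ [p (i + 1), p (i + 2)], ?_, ?_, by simp, by rw [List.getLast?_append]; simp, ?_, ?_⟩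
    · grind
    · exact List.isChain_append.mpr ⟨hch', by simpa using ha₁, by simpa using hlast⟩
    · simp only [List.mem_append, List.mem_cons, List.not_mem_nil, or_false]
      rintro v ((rfl | hv) | rfl | rfl)
      all_goals first | omega | exact hdR v hv
    · simp +contextual
  · refine ⟨(p i :: R) ++ [p (i + 2)], ?_, ?_, by simp, by rw [List.getLast?_append]; simp, ?_, ?_⟩
    · grind
    · exact List.isChain_append.mpr ⟨hch', by simp, by simpa using hlast⟩
    · simp only [List.mem_append, List.mem_cons, List.not_mem_nil, or_false]
      rintro v ((rfl | hv) | rfl)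
      all_goals first | omega | exact hdR v hv
    · simp +contextual

/-- Segments starting at every third vertex of a geodesic can be joined to a single path. -/
theorem exists_concat (hp : IsGeodesic G r h p) {c : ℕ} {s : ℕ → List V} (m : ℕ)
    (hm : ∀ j < m, 3 * j + c + 2 ≤ h)
    (hs : ∀ i, i + 2 ≤ h → (s i).Nodup ∧ (s i).IsChain G.Adj ∧ (s i).head? = some (p i) ∧
      (s i).getLast? = some (p (i + 2)) ∧ ∀ v ∈ s i, i ≤ G.dist r v ∧ G.dist r v ≤ i + 2) :
    ∃ l : List V, l.Nodup ∧ l.IsChain G.Adj ∧ (∀ v ∈ l, G.dist r v < 3 * m + c) ∧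
      (∀ x ∈ l.getLast?, ∃ j, j + 1 = 3 * m + c ∧ x = p j) ∧
      ∀ j < m, ∀ v ∈ s (3 * j + c), v ∈ l := by
  induction m with
  | zero => exact ⟨[], by simp⟩
  | succ m ih =>
    obtain ⟨l, hnd, hch, hlt, hlast, hmem⟩ := ih fun j hj => hm j (by omega)
    have hmh := hm m (by omega)
    obtain ⟨hsnd, hsch, hshead, hslast, hsdist⟩ := hs (3 * m + c) hmh
    refine ⟨l ++ s (3 * m + c), ?_, ?_, ?_, ?_, ?_⟩
    · refine List.nodup_append'.mpr ⟨hnd, hsnd, fun v hv hv' => ?_⟩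
      have h₁ := hlt v hv
      have h₂ := hsdist v hv'
      omega
    · refine List.isChain_append.mpr ⟨hch, hsch, fun x hx y hy => ?_⟩
      obtain ⟨j, hj, rfl⟩ := hlast x hx
      rw [hshead, Option.mem_some_iff] at hy
      rw [← hy, ← hj]
      exact hp.adj j (by omega)
    · intro v hv
      obtain hv | hv := List.mem_append.mp hv
      · have := hlt v hv
        omega
      · have := hsdist v hv
        omega
    · intro x hx
      rw [List.getLast?_append, hslast] at hx
      exact ⟨3 * m + c + 2, by ring, by simpa [eq_comm] using hx⟩
    · intro j hj v hv
      rw [List.mem_append]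
      obtain rfl | hne := eq_or_ne j m
      · exact Or.inr hv
      · exact Or.inl (hmem j (by omega) v hv)

theorem coveredBy_detour [Finite V] (hG : G.Connected) (hp : IsGeodesic G r h p) {n : ℕ}
    (hS : ¬ HasInducedCopyG (StarG n) G) :
    CoveredBy G {w | ∃ i, i + 2 ≤ h ∧ w ∈ detour G h p i} (3 * n) := by
  choose R hR hcov using fun i => ((indepBound_neighborSet hS (p i)).mono
    (S := detour G h p i) fun w hw => hw.2.1.symm).exists_paths
  choose! s hsnd hsch hshead hslast hsdist hsR using fun i k (hi : i + 2 ≤ h) =>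
    hp.exists_segment hG hi (hR i k).1 (hR i k).2.1 (hR i k).2.2
  choose l hnd hch _ _ hl using fun (c k : ℕ) =>
    hp.exists_concat (c := c) (s := fun i => s i k) ((h + 1 - c) / 3) (by omega)
      fun i hi => ⟨hsnd i k hi, hsch i k hi, hshead i k hi, hslast i k hi, hsdist i k hi⟩
  have := CoveredBy.biUnion (G := G) (Finset.range 3 ×ˢ Finset.range n)
    (S := fun x => {v | v ∈ l x.1 x.2}) fun x _ => coveredBy_of_list (hnd x.1 x.2) (hch x.1 x.2)
  rw [Finset.card_product, Finset.card_range, Finset.card_range, mul_one] at this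
  refine this.mono ?_
  rintro w ⟨i, hi, hw⟩
  obtain ⟨k, hk, hwk⟩ := hcov i w hw
  refine Set.mem_iUnion₂.mpr ⟨(i % 3, k), ?_, hl (i % 3) k (i / 3) (by omega) w ?_⟩
  · simp only [Finset.mem_product, Finset.mem_range]
    omega
  · rw [Nat.div_add_mod]
    exact hsR i k hi w hwk

/-- Away from its start, the closed neighbourhood of a geodesic together with a ball around its
end is covered by boundedly many paths. -/
theorem coveredBy_nbhd [Finite V] (hG : G.Connected) (hp : IsGeodesic G r h p) {n : ℕ}
    (hn : 0 < n) (hS : ¬ HasInducedCopyG (StarG n) G) (hF₁ : ¬ HasInducedCopyG (F1G n) G)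
    (hF₂ : ¬ HasInducedCopyG (F2G n) G) {d k : ℕ} (hd : n + 2 ≤ d)
    (hk : IndepBound G {v | G.dist (p h) v ≤ d} k) :
    CoveredBy G {v | n + 2 < G.dist r v ∧
      ((∃ i ≤ h, v = p i ∨ G.Adj v (p i)) ∨ G.dist (p h) v ≤ d)} (k + 1 + 3 * n) := by
  refine ((hk.coveredBy.union hp.coveredBy_range).union (hp.coveredBy_detour hG hS)).mono ?_
  rintro v ⟨hrv, ⟨i, hi, rfl | hvi⟩ | hv⟩
  · exact Or.inl (Or.inr ⟨i, hi, rfl⟩)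
  · by_cases hon : ∃ j ≤ h, v = p j
    · exact Or.inl (Or.inr hon)
    push Not at hon
    have h₁ := dist_le_dist_add_one hG r hvi.symm
    rw [hp.dist i hi] at h₁
    by_cases hih : i + n + 2 ≤ h
    · obtain ⟨a, hah, ha⟩ := (hp.of_adj_middle hG hn hF₁ hF₂ hon hvi (by omega) hih).1
      exact Or.inr ⟨a, hah, hon, ha⟩
    · refine Or.inl (Or.inl ?_)
      have h₂ := dist_le_dist_add_one hG (p h) hvi.symm
      have h₃ := hp.dist_add_le hG (i := i) (k := h - i) (by omega)
      rw [Nat.add_sub_cancel' hi, G.dist_comm] at h₃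
      rw [Set.mem_ofPred_eq]
      omega
  · exact Or.inl (Or.inl hv)

/-- Two geodesics from `r` that are close at distance `n + 4` from `r` stay close until the end
of the longer one is near. -/
theorem near_or_dist_le (hG : G.Connected) (hp : IsGeodesic G r h p) {n : ℕ}
    (hn : 0 < n) (hF₁ : ¬ HasInducedCopyG (F1G n) G) (hF₂ : ¬ HasInducedCopyG (F2G n) G)
    {m : ℕ} {q : ℕ → V} (hq : IsGeodesic G r m q) (hmh : m ≤ h) (hm : n + 4 ≤ m)
    (hpq : q (n + 4) = p (n + 4) ∨ G.Adj (q (n + 4)) (p (n + 4))) :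
    (∃ i ≤ h, q m = p i ∨ G.Adj (q m) (p i)) ∨ G.dist (p h) (q m) ≤ 2 * n + 6 := by
  classical
  obtain ⟨j, hjm, hj, ⟨i, hi, hji⟩, hmax⟩ : ∃ j ≤ m, n + 4 ≤ j ∧
      (∃ i ≤ h, q j = p i ∨ G.Adj (q j) (p i)) ∧
      ∀ j' ≤ m, j < j' → ¬ ∃ i ≤ h, q j' = p i ∨ G.Adj (q j') (p i) := by
    have hstart : ∃ i ≤ h, q (n + 4) = p i ∨ G.Adj (q (n + 4)) (p i) :=
      ⟨n + 4, by omega, hpq⟩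
    exact ⟨_, Nat.findGreatest_le m, Nat.le_findGreatest hm hstart,
      Nat.findGreatest_spec (P := fun j => ∃ i ≤ h, q j = p i ∨ G.Adj (q j) (p i)) hm hstart,
      fun j' hj' hlt => Nat.findGreatest_is_greatest hlt hj'⟩
  obtain rfl | hlt := hjm.eq_or_lt
  · exact Or.inl ⟨i, hi, hji⟩
  have hfar := hmax (j + 1) hlt (by omega)
  have hoff : ∀ i ≤ h, q j ≠ p i := fun i hi hqp =>
    hfar ⟨i, hi, Or.inr (hqp ▸ (hq.adj j hlt).symm)⟩
  have hadj : G.Adj (q j) (p i) := hji.resolve_left (hoff i hi)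
  have h₁ := dist_le_dist_add_one hG r hadj
  have h₂ := dist_le_dist_add_one hG r hadj.symm
  rw [hp.dist i hi, hq.dist j hjm] at h₁ h₂
  by_cases hih : i + n + 2 ≤ h
  · exact absurd ((hp.of_adj_middle hG hn hF₁ hF₂ hoff hadj (by omega) hih).2 _ (hq.adj j hlt)) hfar
  · right
    have h₃ := hp.dist_add_le hG (i := i) (k := h - i) (by omega)
    have h₄ := hq.dist_add_le hG (i := j) (k := m - j) (by omega)
    rw [Nat.add_sub_cancel' hi, G.dist_comm] at h₃
    rw [Nat.add_sub_cancel' hjm] at h₄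
    have h₅ := dist_le_dist_add_one hG (p h) hadj.symm
    have h₆ := hG.dist_triangle (u := p h) (v := q j) (w := q m)
    omega

end IsGeodesic

/-- Greedy choice: pairwise unrelated elements that dominate all others, where every element is
dominated by one of at least the same weight. -/
theorem exists_unrelated_dominating {α : Type} (A : Finset α) (w : α → ℕ) {rel : α → α → Prop}
    (hrefl : ∀ a, rel a a) (hsymm : ∀ a b, rel a b → rel b a) :
    ∃ M ⊆ A, (∀ a ∈ M, ∀ b ∈ M, a ≠ b → ¬ rel a b) ∧
      ∀ a ∈ A, ∃ e ∈ M, w a ≤ w e ∧ rel a e := by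
  classical
  induction A using Finset.strongInduction with
  | H A ih =>
    obtain rfl | hA := A.eq_empty_or_nonempty
    · exact ⟨∅, by simp⟩
    obtain ⟨e, he, hmax⟩ := A.exists_max_image w hA
    obtain ⟨M, hMA, hM, hdom⟩ := ih (A.filter fun a => ¬ rel a e)
      (Finset.filter_ssubset.mpr ⟨e, he, by simpa using hrefl e⟩)
    have hMe : ∀ a ∈ M, ¬ rel a e := fun a ha => (Finset.mem_filter.mp (hMA ha)).2
    refine ⟨insert e M, Finset.insert_subset he (hMA.trans (Finset.filter_subset _ _)), ?_, ?_⟩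
    · intro a ha b hb hab
      obtain rfl | ha' := Finset.mem_insert.mp ha
      · obtain rfl | hb' := Finset.mem_insert.mp hb
        · exact absurd rfl hab
        · exact fun h => hMe b hb' (hsymm _ _ h)
      · obtain rfl | hb' := Finset.mem_insert.mp hb
        · exact hMe a ha'
        · exact hM a ha' b hb' hab
    · intro a ha
      by_cases hae : rel a e
      · exact ⟨e, Finset.mem_insert_self _ _, hmax a ha, hae⟩
      · obtain ⟨e', he', h⟩ := hdom a (Finset.mem_filter.mpr ⟨ha, hae⟩)
        exact ⟨e', Finset.mem_insert_of_mem he', h⟩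

end PathCover

/-- Chiba–Furuya. For every `n ≥ 2` there is a constant `c₀ = c₀(n)`
such that `pc(G) ≤ c₀` for every connected `{K*_n, K_{1,n}, F^(1)_n, F^(2)_n}`-free
graph `G`. -/
theorem pcG_bounded_of_F1 (n : ℕ) (hn : 2 ≤ n) :
    ∃ c : ℕ, ∀ (V : Type) (_ : Fintype V) (G : SimpleGraph V),
      G.Connected →
      ¬ HasInducedCopyG (KStarG n) G →
      ¬ HasInducedCopyG (StarG n) G →
      ¬ HasInducedCopyG (F1G n) G →
      ¬ HasInducedCopyG (F2G n) G →
      pcG G ≤ c := by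
  classical
  obtain ⟨k₁, hk₁⟩ := PathCover.exists_indepBound_ball n (n + 4)
  obtain ⟨k₂, hk₂⟩ := PathCover.exists_indepBound_ball n (2 * n + 6)
  refine ⟨k₁ + k₁ * (k₂ + 1 + 3 * n), fun V _ G hG hK hS hF₁ hF₂ => ?_⟩
  have hn₀ : 0 < n := by omega
  obtain ⟨r⟩ := hG.nonempty
  have hball : PathCover.IndepBound G {v | G.dist r v ≤ n + 4} k₁ := hk₁ G hG hK hS r
  choose p hp hpe using PathCover.exists_isGeodesic hG r
  obtain ⟨M, hMA, hM, hdom⟩ := PathCover.exists_unrelated_dominating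
    (Finset.univ.filter fun v => n + 4 ≤ G.dist r v) (G.dist r)
    (rel := fun u v => p u (n + 4) = p v (n + 4) ∨ G.Adj (p u (n + 4)) (p v (n + 4)))
    (fun _ => Or.inl rfl) fun _ _ h => h.imp Eq.symm SimpleGraph.Adj.symm
  have hMcard : M.card ≤ k₁ := by
    rw [← Finset.card_image_of_injOn (f := fun v => p v (n + 4)) fun u hu v hv huv => by
      by_contra hne
      exact hM u hu v hv hne (Or.inl huv)]
    refine hball _ ?_ ?_
    · intro x hx
      obtain ⟨v, hv, rfl⟩ := Finset.mem_image.mp hx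
      exact ((hp v).dist _ (Finset.mem_filter.mp (hMA hv)).2).le
    · intro x hx y hy hxy hadj
      obtain ⟨u, hu, rfl⟩ := Finset.mem_image.mp hx
      obtain ⟨v, hv, rfl⟩ := Finset.mem_image.mp hy
      exact hM u hu v hv (fun huv => hxy (by rw [huv])) (Or.inr hadj)
  have hcov := PathCover.CoveredBy.biUnion M fun e _ =>
    (hp e).coveredBy_nbhd hG hn₀ hS hF₁ hF₂ (d := 2 * n + 6) (by omega) (hk₂ G hG hK hS _)
  refine ((hball.coveredBy.union hcov).mono fun v _ => ?_).pcG_le.trans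
    (Nat.add_le_add_left (Nat.mul_le_mul_right _ hMcard) _)
  by_cases hv : G.dist r v ≤ n + 4
  · exact Or.inl hv
  · obtain ⟨e, he, hve, hrel⟩ := hdom v (by simp; omega)
    have := (hp e).near_or_dist_le hG hn₀ hF₁ hF₂ (hp v) hve (by omega) hrel
    rw [hpe v] at this
    exact Or.inr (Set.mem_iUnion₂.mpr ⟨e, he, by omega, this⟩)
end

section
/- For every integer n ≥ 2 there exists a constant c′₀ = c′₀(n), depending only on n, such that pp(G) ≤ c′₀ for every connected {K*_n, K_{1,n}, F^(1)_n, F^(2)_n, F^(3)_n, F^(4)_n}-free graph G. -/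
/-- The vertices `p i` with `lo ≤ i ≤ hi` form an induced path of `G`, in this order. -/
def InducedPathOn {V : Type} (G : SimpleGraph V) (p : ℤ → V) (lo hi : ℤ) : Prop :=
  ∀ i j : ℤ, lo ≤ i → i ≤ hi → lo ≤ j → j ≤ hi →
    (p i = p j → i = j) ∧ (G.Adj (p i) (p j) ↔ i = j + 1 ∨ j = i + 1)

namespace InducedPathOn

variable {V : Type} {G : SimpleGraph V} {p : ℤ → V} {lo hi : ℤ}

theorem mono (hp : InducedPathOn G p lo hi) {lo' hi' : ℤ} (hlo : lo ≤ lo') (hhi : hi' ≤ hi) :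
    InducedPathOn G p lo' hi' :=
  fun i j hi1 hi2 hj1 hj2 => hp i j (by omega) (by omega) (by omega) (by omega)

theorem reverse (hp : InducedPathOn G p lo hi) (m : ℤ) :
    InducedPathOn G (fun i => p (m - i)) (m - hi) (m - lo) := by
  intro i j hi1 hi2 hj1 hj2
  have h := hp (m - i) (m - j) (by omega) (by omega) (by omega) (by omega)
  refine ⟨fun e => by have := h.1 e; omega, h.2.trans ?_⟩
  omega

/-- Rerouting an induced path through a vertex `v` whose neighbours on it lie between `a` and
`b`. -/
theorem reroute (hp : InducedPathOn G p lo hi) {v : V} {a b : ℤ}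
    (hv : ∀ i, lo ≤ i → i ≤ hi → v ≠ p i) (ha : lo ≤ a) (hb : b ≤ hi) (hab : a + 2 ≤ b)
    (hva : G.Adj v (p a)) (hvb : G.Adj v (p b))
    (hS : ∀ i, lo ≤ i → i ≤ hi → G.Adj v (p i) → a ≤ i ∧ i ≤ b) :
    InducedPathOn G (fun i => if i ≤ a then p i else if i = a + 1 then v else p (i + (b - a - 2)))
      lo (hi - (b - a - 2)) := by
  have key : ∀ i, lo ≤ i → i ≤ hi → (i ≤ a ∨ b ≤ i) → (G.Adj v (p i) ↔ i = a ∨ i = b) := by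
    intro i h1 h2 h3
    constructor
    · intro h
      have := hS i h1 h2 h
      omega
    · rintro (rfl | rfl) <;> assumption
  intro i j hi1 hi2 hj1 hj2
  dsimp only
  split_ifs with h1 h2 h3 h4 h5 h6 h7 h8
  · exact hp i j (by omega) (by omega) (by omega) (by omega)
  · refine ⟨fun e => (hv i (by omega) (by omega) e.symm).elim, ?_⟩
    rw [G.adj_comm, key i (by omega) (by omega) (by omega)]
    omega
  · have := hp i (j + (b - a - 2)) (by omega) (by omega) (by omega) (by omega)
    refine ⟨fun e => by have := this.1 e; omega, this.2.trans ?_⟩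
    omega
  · refine ⟨fun e => (hv j (by omega) (by omega) e).elim, ?_⟩
    rw [key j (by omega) (by omega) (by omega)]
    omega
  · subst h4 h6
    simp
  · refine ⟨fun e => (hv _ (by omega) (by omega) e).elim, ?_⟩
    rw [key _ (by omega) (by omega) (by omega)]
    omega
  · have := hp (i + (b - a - 2)) j (by omega) (by omega) (by omega) (by omega)
    refine ⟨fun e => by have := this.1 e; omega, this.2.trans ?_⟩
    omega
  · refine ⟨fun e => (hv _ (by omega) (by omega) e.symm).elim, ?_⟩
    rw [G.adj_comm, key _ (by omega) (by omega) (by omega)]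
    omega
  · have := hp (i + (b - a - 2)) (j + (b - a - 2)) (by omega) (by omega) (by omega) (by omega)
    refine ⟨fun e => by have := this.1 e; omega, this.2.trans ?_⟩
    omega

variable {n : ℕ}

/-- No vertex hangs off an interior vertex of a long induced path. -/
theorem false_of_F1G (h : ¬ HasInducedCopyG (F1G n) G) {c : ℤ}
    (hp : InducedPathOn G p (c - n) (c + n)) {x : V}
    (hx : ∀ i, c - n ≤ i → i ≤ c + n → x ≠ p i ∧ (G.Adj x (p i) ↔ i = c)) : False := by
  apply h
  refine ⟨fun w => match w with
    | Sum.inl i => if i.val = 0 then p c else x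
    | Sum.inr (Sum.inl j) => p (c - 1 - j)
    | Sum.inr (Sum.inr j) => p (c + 1 + j), ?_, ?_⟩
  · rintro (i | i | i) (j | j | j) e <;> dsimp only at e <;>
      grind [InducedPathOn]
  · rintro (i | i | i) (j | j | j) <;> dsimp only <;>
      simp only [F1G, SimpleGraph.fromRel_adj] <;>
      grind [InducedPathOn, SimpleGraph.adj_comm, SimpleGraph.irrefl]

/-- A neighbour of a vertex attached to exactly one edge of a long induced path has itself a
neighbour on that path. -/
theorem false_of_F2G (h : ¬ HasInducedCopyG (F2G n) G) {c : ℤ}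
    (hp : InducedPathOn G p (c - n) (c + n + 1)) {x w : V}
    (hx : ∀ i, c - n ≤ i → i ≤ c + n + 1 → x ≠ p i ∧ (G.Adj x (p i) ↔ i = c ∨ i = c + 1))
    (hw : ∀ i, c - n ≤ i → i ≤ c + n + 1 → w ≠ p i ∧ ¬ G.Adj w (p i)) (hxw : G.Adj x w) :
    False := by
  have hne := hxw.ne
  apply h
  refine ⟨fun w' => match w' with
    | Sum.inl i => if i.val = 0 then x else w
    | Sum.inr (Sum.inl j) => p (c - j)
    | Sum.inr (Sum.inr j) => p (c + 1 + j), ?_, ?_⟩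
  · rintro (i | i | i) (j | j | j) e <;> dsimp only at e <;>
      grind [InducedPathOn]
  · rintro (i | i | i) (j | j | j) <;> dsimp only <;>
      simp only [F2G, F1G, YZEdgeG, SimpleGraph.sup_adj, SimpleGraph.fromRel_adj] <;>
      grind [InducedPathOn, SimpleGraph.adj_comm, SimpleGraph.irrefl]

/-- No vertex is attached to a long induced path exactly at the two neighbours of an interior
vertex. -/
theorem false_of_F3G (h : ¬ HasInducedCopyG (F3G n) G) {c : ℤ}
    (hp : InducedPathOn G p (c - n) (c + n)) (hn : 1 ≤ n) {x : V}
    (hx : ∀ i, c - n ≤ i → i ≤ c + n → x ≠ p i ∧ (G.Adj x (p i) ↔ i = c - 1 ∨ i = c + 1)) :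
    False := by
  apply h
  refine ⟨fun w' => match w' with
    | Sum.inl i => if i.val = 0 then x else p c
    | Sum.inr (Sum.inl j) => p (c - 1 - j)
    | Sum.inr (Sum.inr j) => p (c + 1 + j), ?_, ?_⟩
  · rintro (i | i | i) (j | j | j) e <;> dsimp only at e <;>
      grind [InducedPathOn]
  · rintro (i | i | i) (j | j | j) <;> dsimp only <;>
      simp only [F3G, SimpleGraph.fromRel_adj] <;>
      grind [InducedPathOn, SimpleGraph.adj_comm, SimpleGraph.irrefl]

/-- Two vertices attached to the same single edge of a long induced path are adjacent. -/
theorem false_of_F4G (h : ¬ HasInducedCopyG (F4G n) G) {c : ℤ}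
    (hp : InducedPathOn G p (c - n) (c + n + 1)) {x w : V}
    (hx : ∀ i, c - n ≤ i → i ≤ c + n + 1 → x ≠ p i ∧ (G.Adj x (p i) ↔ i = c ∨ i = c + 1))
    (hw : ∀ i, c - n ≤ i → i ≤ c + n + 1 → w ≠ p i ∧ (G.Adj w (p i) ↔ i = c ∨ i = c + 1))
    (hne : x ≠ w) (hxw : ¬ G.Adj x w) : False := by
  apply h
  refine ⟨fun w' => match w' with
    | Sum.inl i => if i.val = 0 then x else w
    | Sum.inr (Sum.inl j) => p (c - j)
    | Sum.inr (Sum.inr j) => p (c + 1 + j), ?_, ?_⟩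
  · rintro (i | i | i) (j | j | j) e <;> dsimp only at e <;>
      grind [InducedPathOn]
  · rintro (i | i | i) (j | j | j) <;> dsimp only <;>
      simp only [F4G, F3G, YZEdgeG, SimpleGraph.sup_adj, SimpleGraph.fromRel_adj] <;>
      grind [InducedPathOn, SimpleGraph.adj_comm, SimpleGraph.irrefl]

end InducedPathOn

/-- `G` contains none of the four graphs `F^(1)_n`, …, `F^(4)_n` as an induced subgraph. -/
structure ForkFree {V : Type} (n : ℕ) (G : SimpleGraph V) : Prop where
  one_le : 1 ≤ n
  F1 : ¬ HasInducedCopyG (F1G n) G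
  F2 : ¬ HasInducedCopyG (F2G n) G
  F3 : ¬ HasInducedCopyG (F3G n) G
  F4 : ¬ HasInducedCopyG (F4G n) G

namespace ForkFree

variable {V : Type} {G : SimpleGraph V} {p : ℤ → V} {lo hi : ℤ} {n : ℕ}

open InducedPathOn

/-- The neighbours of an outside vertex on a long induced path, if they avoid both ends, are two
to four consecutive vertices. -/
theorem nbrs_consecutive (hF : ForkFree n G) (hp : InducedPathOn G p lo hi) {v : V} {a b : ℤ}
    (hv : ∀ i, lo ≤ i → i ≤ hi → v ≠ p i) (ha : lo + (n + 1) ≤ a) (hb : b + (n + 1) ≤ hi)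
    (hab : a ≤ b) (hva : G.Adj v (p a)) (hvb : G.Adj v (p b))
    (hS : ∀ i, lo ≤ i → i ≤ hi → G.Adj v (p i) → a ≤ i ∧ i ≤ b) :
    a + 1 ≤ b ∧ b ≤ a + 3 ∧ ∀ i, lo ≤ i → i ≤ hi → (G.Adj v (p i) ↔ a ≤ i ∧ i ≤ b) := by
  have hpp := hp
  unfold InducedPathOn at hpp
  rcases eq_or_lt_of_le hab with rfl | hab
  · exfalso
    refine false_of_F1G hF.F1 (c := a) (hp.mono (by omega) (by omega)) (x := v) ?_
    intro i h1 h2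
    refine ⟨hv i (by omega) (by omega), fun h => ?_, fun h => h ▸ hva⟩
    have := hS i (by omega) (by omega) h
    omega
  rcases eq_or_lt_of_le (show a + 1 ≤ b from hab) with rfl | hab
  · grind
  have hq := hp.reroute hv (by omega) (by omega) (by omega) hva hvb hS
  have h3 : b = a + 2 → G.Adj v (p (a + 1)) := by
    intro hb2
    by_contra hcon
    refine false_of_F3G hF.F3 (c := a + 1) (hp.mono (by omega) (by omega)) hF.one_le (x := v) ?_
    intro i h1 h2
    refine ⟨hv i (by omega) (by omega), ?_, ?_⟩
    · intro h
      have := hS i (by omega) (by omega) h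
      have : i ≠ a + 1 := by rintro rfl; exact hcon h
      omega
    · rintro (rfl | rfl)
      · simpa using hva
      · rw [show a + 1 + 1 = b by omega]; exact hvb
  have h4 : a + 3 ≤ b → G.Adj v (p (a + 1)) := by
    intro hb2
    by_contra hcon
    rw [G.adj_comm] at hcon
    refine false_of_F1G hF.F1 (c := a) (hq.mono (by omega) (by omega)) (x := p (a + 1)) ?_
    intro i h1 h2
    split_ifs <;> grind
  have h5 : a + 3 ≤ b → G.Adj v (p (b - 1)) := by
    intro hb2
    by_contra hcon
    rw [G.adj_comm] at hcon
    refine false_of_F1G hF.F1 (c := a + 2) (hq.mono (by omega) (by omega)) (x := p (b - 1)) ?_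
    intro i h1 h2
    split_ifs <;> grind
  have h6 : b ≤ a + 3 := by
    by_contra hb2
    by_cases hcon : G.Adj v (p (a + 2))
    · rw [G.adj_comm] at hcon
      refine false_of_F1G hF.F1 (c := a + 1) (hq.mono (by omega) (by omega)) (x := p (a + 2)) ?_
      intro i h1 h2
      split_ifs <;> grind
    · rw [G.adj_comm] at hcon
      have h7 := h4 (by omega)
      rw [G.adj_comm] at h7
      refine false_of_F2G hF.F2 (c := a) (hq.mono (by omega) (by omega)) (x := p (a + 1))
        (w := p (a + 2)) ?_ ?_ ?_
      · intro i h1 h2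
        split_ifs <;> grind
      · intro i h1 h2
        split_ifs <;> grind
      · grind
  refine ⟨by omega, h6, fun i h1 h2 => ⟨hS i h1 h2, fun ⟨h7, h8⟩ => ?_⟩⟩
  have : i = a ∨ i = b ∨ i = a + 1 ∨ i = b - 1 := by omega
  grind

/-- A neighbour of a vertex attached to the interior of a long induced path has itself a
neighbour on that path. -/
theorem exists_adj_of_adj (hF : ForkFree n G) (hp : InducedPathOn G p lo hi) {v w : V} {a b : ℤ}
    (hv : ∀ i, lo ≤ i → i ≤ hi → v ≠ p i) (ha : lo + (n + 1) ≤ a) (hb : b + (n + 1) ≤ hi)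
    (hab : a + 1 ≤ b)
    (hS : ∀ i, lo ≤ i → i ≤ hi → (G.Adj v (p i) ↔ a ≤ i ∧ i ≤ b))
    (hw : ∀ i, lo ≤ i → i ≤ hi → w ≠ p i) (hvw : G.Adj v w) :
    ∃ i, lo ≤ i ∧ i ≤ hi ∧ G.Adj w (p i) := by
  by_contra! hcon
  rcases eq_or_lt_of_le hab with rfl | hab
  · refine false_of_F2G hF.F2 (c := a) (hp.mono (by omega) (by omega)) (x := v) (w := w)
      ?_ ?_ hvw
    · intro i h1 h2
      refine ⟨hv i (by omega) (by omega), (hS i (by omega) (by omega)).trans (by omega)⟩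
    · intro i h1 h2
      exact ⟨hw i (by omega) (by omega), hcon i (by omega) (by omega)⟩
  · have hq := hp.reroute hv (by omega) (by omega) (by omega)
      ((hS a (by omega) (by omega)).2 (by omega)) ((hS b (by omega) (by omega)).2 (by omega))
      (fun i h1 h2 => (hS i h1 h2).1)
    have hne := hvw.ne
    rw [G.adj_comm] at hvw
    refine false_of_F1G hF.F1 (c := a + 1) (hq.mono (by omega) (by omega)) (x := w) ?_
    intro i h1 h2
    split_ifs <;> grind

/-- Two vertices attached to the interior of a long induced path with the same first neighbour
are adjacent. -/
theorem adj_of_same_first (hF : ForkFree n G) (hp : InducedPathOn G p lo hi) {v w : V}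
    {a b b' : ℤ} (hv : ∀ i, lo ≤ i → i ≤ hi → v ≠ p i) (hw : ∀ i, lo ≤ i → i ≤ hi → w ≠ p i)
    (ha : lo + (n + 1) ≤ a) (hb : b + (n + 1) ≤ hi) (hab : a + 1 ≤ b') (hbb : b' ≤ b)
    (hS : ∀ i, lo ≤ i → i ≤ hi → (G.Adj v (p i) ↔ a ≤ i ∧ i ≤ b))
    (hS' : ∀ i, lo ≤ i → i ≤ hi → (G.Adj w (p i) ↔ a ≤ i ∧ i ≤ b'))
    (hne : v ≠ w) : G.Adj v w := by
  by_contra hcon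
  by_cases hb1 : b = a + 1
  · refine false_of_F4G hF.F4 (c := a) (hp.mono (by omega) (by omega)) (x := v) (w := w)
      ?_ ?_ hne hcon
    · intro i h1 h2
      refine ⟨hv i (by omega) (by omega), (hS i (by omega) (by omega)).trans (by omega)⟩
    · intro i h1 h2
      refine ⟨hw i (by omega) (by omega), (hS' i (by omega) (by omega)).trans (by omega)⟩
  have hq := hp.reroute hv (by omega) (by omega) (by omega)
      ((hS a (by omega) (by omega)).2 (by omega)) ((hS b (by omega) (by omega)).2 (by omega))
      (fun i h1 h2 => (hS i h1 h2).1)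
  rw [G.adj_comm] at hcon
  rcases eq_or_lt_of_le hbb with rfl | hbb
  · refine false_of_F3G hF.F3 (c := a + 1) (hq.mono (by omega) (by omega)) hF.one_le (x := w) ?_
    intro i h1 h2
    split_ifs <;> grind
  · refine false_of_F1G hF.F1 (c := a) (hq.mono (by omega) (by omega)) (x := w) ?_
    intro i h1 h2
    split_ifs <;> grind

end ForkFree

/-- Every sufficiently large set of vertices contains a large clique or a large independent
set. -/
theorem exists_ramsey (a b : ℕ) : ∃ R : ℕ, ∀ (V : Type) (G : SimpleGraph V) (s : Finset V),
    R ≤ s.card → (∃ t ⊆ s, t.card = a ∧ G.IsClique t) ∨ (∃ t ⊆ s, t.card = b ∧ G.IsIndepSet t) := by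
  classical
  induction a generalizing b with
  | zero => exact ⟨0, fun V G s _ => Or.inl ⟨∅, by simp⟩⟩
  | succ a iha =>
    induction b with
    | zero => exact ⟨0, fun V G s _ => Or.inr ⟨∅, by simp⟩⟩
    | succ b ihb =>
      obtain ⟨R₁, h₁⟩ := iha (b + 1)
      obtain ⟨R₂, h₂⟩ := ihb
      refine ⟨R₁ + R₂ + 1, fun V G s hs => ?_⟩
      obtain ⟨v, hv⟩ : s.Nonempty := Finset.card_pos.1 (by omega)
      have hcard : ((s.erase v).filter (G.Adj v)).card +
          ((s.erase v).filter (fun w => ¬ G.Adj v w)).card = s.card - 1 := by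
        rw [Finset.card_filter_add_card_filter_not, Finset.card_erase_of_mem hv]
      have hsub : ∀ (q : V → Prop) [DecidablePred q], (s.erase v).filter q ⊆ s := fun q _ =>
        (Finset.filter_subset _ _).trans (Finset.erase_subset _ _)
      by_cases hR : R₁ ≤ ((s.erase v).filter (G.Adj v)).card
      · rcases h₁ V G _ hR with ⟨t, ht, hc, hq⟩ | ⟨t, ht, hc, hq⟩
        · left
          have hadj : ∀ w ∈ t, G.Adj v w := fun w hw => (Finset.mem_filter.1 (ht hw)).2
          refine ⟨insert v t, Finset.insert_subset hv (ht.trans (hsub _)), ?_, ?_⟩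
          · rw [Finset.card_insert_of_notMem (fun h => (hadj v h).ne rfl), hc]
          · rw [Finset.coe_insert, SimpleGraph.isClique_insert]
            exact ⟨hq, fun w hw _ => hadj w hw⟩
        · exact Or.inr ⟨t, ht.trans (hsub _), hc, hq⟩
      · rcases h₂ V G ((s.erase v).filter (fun w => ¬ G.Adj v w)) (by omega) with
          ⟨t, ht, hc, hq⟩ | ⟨t, ht, hc, hq⟩
        · exact Or.inl ⟨t, ht.trans (hsub _), hc, hq⟩
        · right
          have hadj : ∀ w ∈ t, ¬ G.Adj v w := fun w hw => (Finset.mem_filter.1 (ht hw)).2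
          refine ⟨insert v t, Finset.insert_subset hv (ht.trans (hsub _)), ?_, ?_⟩
          · rw [Finset.card_insert_of_notMem, hc]
            intro h
            have := ht h
            simp at this
          · rw [Finset.coe_insert]
            intro x hx y hy hxy
            rcases hx with rfl | hx <;> rcases hy with rfl | hy
            · exact (hxy rfl).elim
            · exact hadj y hy
            · exact fun h => hadj x hx h.symm
            · exact hq hx hy hxy

/-- Every independent set of `G` contained in `X` has at most `c` elements. -/
def IndepBoundedOn {V : Type} (G : SimpleGraph V) (X : Set V) (c : ℕ) : Prop :=
  ∀ s : Finset V, ↑s ⊆ X → G.IsIndepSet s → s.card ≤ c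

/-- In a `K_{1,n}`-free graph the neighbours of a vertex in an independent set are fewer than
`n`. -/
theorem card_lt_of_starFree {V : Type} {G : SimpleGraph V} {n : ℕ}
    (h : ¬ HasInducedCopyG (StarG n) G) {v : V} {s : Finset V} (hs : G.IsIndepSet s)
    (hv : ∀ w ∈ s, G.Adj v w) : s.card < n := by
  by_contra! hcon
  obtain ⟨t, hts, ht⟩ := Finset.exists_subset_card_eq hcon
  let e := (Finset.equivFinOfCardEq ht).symm
  have he : ∀ i, (e i : V) ∈ s := fun i => hts (e i).2
  have hinj : ∀ i j, (e i : V) = e j → i = j := fun i j hij => e.injective (Subtype.ext hij)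
  apply h
  refine ⟨fun w => match w with
    | Sum.inl _ => v
    | Sum.inr i => (e i : V), ?_, ?_⟩
  · rintro (i | i) (j | j) hij <;> dsimp only at hij
    · rfl
    · exact ((hv _ (he j)).ne hij).elim
    · exact ((hv _ (he i)).ne hij.symm).elim
    · rw [hinj i j hij]
  · rintro (i | i) (j | j) <;> dsimp only <;> simp only [StarG, SimpleGraph.fromRel_adj]
    · simp
    · simpa using hv _ (he j)
    · simpa using (hv _ (he i)).symm
    · suffices ¬ G.Adj (e i : V) (e j) by simpa
      intro hadj
      exact hs (he i) (he j) hadj.ne hadj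

/-- In a `K*_n`-free graph, fewer than `n` vertices of a clique have private neighbours in an
independent set. -/
theorem card_lt_of_kStarFree {V : Type} {G : SimpleGraph V} {n : ℕ}
    (h : ¬ HasInducedCopyG (KStarG n) G) {s : Finset V} (hs : G.IsClique s) {Y : Set V}
    (hY : G.IsIndepSet Y) {f : V → V} (hf : ∀ x ∈ s, f x ∈ Y)
    (hadj : ∀ x ∈ s, ∀ x' ∈ s, (G.Adj x' (f x) ↔ x' = x)) (hne : ∀ x ∈ s, f x ∉ s) :
    s.card < n := by
  by_contra! hcon
  obtain ⟨t, hts, ht⟩ := Finset.exists_subset_card_eq hcon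
  let e := (Finset.equivFinOfCardEq ht).symm
  have he : ∀ i, (e i : V) ∈ s := fun i => hts (e i).2
  have hinj : ∀ i j, (e i : V) = e j → i = j := fun i j hij => e.injective (Subtype.ext hij)
  apply h
  refine ⟨fun w => match w with
    | Sum.inl i => (e i : V)
    | Sum.inr i => f (e i : V), ?_, ?_⟩
  · rintro (i | i) (j | j) hij <;> dsimp only at hij
    · rw [hinj i j hij]
    · exact (hne _ (he j) (hij ▸ he i)).elim
    · exact (hne _ (he i) (hij ▸ he j)).elim
    · have h1 := (hadj _ (he i) _ (he i)).2 rfl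
      rw [hij, hadj _ (he j) _ (he i)] at h1
      rw [hinj i j h1]
  · rintro (i | i) (j | j) <;> dsimp only <;> simp only [KStarG, SimpleGraph.fromRel_adj]
    · constructor
      · intro h1
        have : i ≠ j := fun hij => h1.ne (by rw [hij])
        simp [this]
      · intro h1
        exact hs (he i) (he j) (fun hij => by simp [hinj i j hij] at h1)
    · rw [hadj _ (he j) _ (he i)]
      constructor
      · intro h1
        simp [hinj i j h1]
      · intro h1
        have : i = j := by simpa using h1
        rw [this]
    · rw [G.adj_comm, hadj _ (he i) _ (he j)]
      constructor
      · intro h1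
        simp [hinj j i h1]
      · intro h1
        have : j = i := by simpa using h1
        rw [this]
    · suffices ¬ G.Adj (f (e i : V)) (f (e j)) by simpa
      intro hadj
      exact hY (hf _ (he i)) (hf _ (he j)) hadj.ne hadj

/-- A bound on the independent subsets of `X` gives one for the closed neighbourhood of `X`. -/
theorem exists_indepBoundedOn_nbhd (n c : ℕ) : ∃ c' : ℕ, ∀ (V : Type) (G : SimpleGraph V)
    (X : Set V), ¬ HasInducedCopyG (KStarG n) G → ¬ HasInducedCopyG (StarG n) G →
    IndepBoundedOn G X c → IndepBoundedOn G {v | v ∈ X ∨ ∃ x ∈ X, G.Adj x v} c' := by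
  classical
  obtain ⟨R, hR⟩ := exists_ramsey n (c + 1)
  refine ⟨c + R * n, fun V G X hK hS hX Y hYX hY => ?_⟩
  have hsplit := Finset.card_filter_add_card_filter_not (s := Y) (fun v => v ∈ X)
  have h1 : (Y.filter (fun v => v ∈ X)).card ≤ c :=
    hX _ (fun v hv => (Finset.mem_filter.1 (Finset.mem_coe.1 hv)).2)
      (hY.mono (Finset.coe_subset.2 (Finset.filter_subset _ _)))
  set Z := Y.filter (fun v => v ∉ X) with hZ
  have hZi : G.IsIndepSet (Z : Set V) := hY.mono (Finset.coe_subset.2 (Finset.filter_subset _ _))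
  have hZX : ∀ z ∈ Z, z ∉ X := fun z hz => (Finset.mem_filter.1 hz).2
  have hdom : ∃ D : Finset V, ↑D ⊆ X ∧ ∀ z ∈ Z, ∃ x ∈ D, G.Adj x z := by
    have : ∀ z, ∃ x, z ∈ Z → x ∈ X ∧ G.Adj x z := by
      intro z
      by_cases hz : z ∈ Z
      · obtain hzX | ⟨x, hx, hxz⟩ := hYX (Finset.mem_coe.2 (Finset.mem_filter.1 hz).1)
        · exact (hZX z hz hzX).elim
        · exact ⟨x, fun _ => ⟨hx, hxz⟩⟩
      · exact ⟨z, fun h => (hz h).elim⟩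
    choose g hg using this
    refine ⟨Z.image g, ?_, fun z hz => ⟨g z, Finset.mem_image_of_mem g hz, (hg z hz).2⟩⟩
    intro x hx
    obtain ⟨z, hz, rfl⟩ := Finset.mem_image.1 (Finset.mem_coe.1 hx)
    exact (hg z hz).1
  obtain ⟨D, ⟨hDX, hD⟩, hmin⟩ := WellFounded.has_min (measure (fun D : Finset V => D.card)).wf
    {D : Finset V | (D : Set V) ⊆ X ∧ ∀ z ∈ Z, ∃ x ∈ D, G.Adj x z}
    (hdom.imp fun _ h => h)
  have hpriv : ∀ x, ∃ z, x ∈ D → z ∈ Z ∧ G.Adj x z ∧ ∀ x' ∈ D, G.Adj x' z → x' = x := by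
    intro x
    by_cases hx : x ∈ D
    · have h2 := hmin (D.erase x)
      have h3 : ¬ ∀ z ∈ Z, ∃ x' ∈ D.erase x, G.Adj x' z := fun h3 =>
        h2 ⟨fun y hy => hDX (Finset.mem_coe.2 (Finset.mem_of_mem_erase (Finset.mem_coe.1 hy))), h3⟩
          (Finset.card_erase_lt_of_mem hx)
      push Not at h3
      obtain ⟨z, hz, h3⟩ := h3
      have h4 : ∀ x' ∈ D, G.Adj x' z → x' = x := by
        intro x' hx' hadj
        by_contra hne
        exact h3 x' (Finset.mem_erase.2 ⟨hne, hx'⟩) hadj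
      obtain ⟨x', hx', hadj⟩ := hD z hz
      exact ⟨z, fun _ => ⟨hz, h4 x' hx' hadj ▸ hadj, h4⟩⟩
    · exact ⟨x, fun h => (hx h).elim⟩
  choose f hf using hpriv
  have hDR : D.card ≤ R := by
    by_contra! hcon
    rcases hR V G D hcon.le with ⟨t, ht, hc, hq⟩ | ⟨t, ht, hc, hq⟩
    · have := card_lt_of_kStarFree hK hq hZi (f := f) (fun x hx => (hf x (ht hx)).1)
        (fun x hx x' hx' => ⟨(hf x (ht hx)).2.2 x' (ht hx'), fun h => h ▸ (hf x (ht hx)).2.1⟩)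
        (fun x hx hmem => hZX _ (hf x (ht hx)).1 (hDX (ht hmem)))
      omega
    · have := hX t (fun x hx => hDX (ht hx)) hq
      omega
  have hZD : Z.card ≤ D.card * n := by
    have hsub : Z ⊆ D.biUnion (fun x => Z.filter (G.Adj x)) := by
      intro z hz
      obtain ⟨x, hx, hxz⟩ := hD z hz
      exact Finset.mem_biUnion.2 ⟨x, hx, Finset.mem_filter.2 ⟨hz, hxz⟩⟩
    refine (Finset.card_le_card hsub).trans (Finset.card_biUnion_le_card_mul _ _ _ fun x _ => ?_)
    exact (card_lt_of_starFree hS (v := x) (hZi.mono (Finset.coe_subset.2 (Finset.filter_subset _ _)))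
      (fun w hw => (Finset.mem_filter.1 hw).2)).le
  have := Nat.mul_le_mul_right n hDR
  omega

/-- Balls of fixed radius contain only independent sets of bounded size. -/
theorem exists_indepBoundedOn_ball (n k : ℕ) : ∃ c : ℕ, ∀ (V : Type) (G : SimpleGraph V) (v : V),
    ¬ HasInducedCopyG (KStarG n) G → ¬ HasInducedCopyG (StarG n) G → G.Connected →
    IndepBoundedOn G {w | G.dist v w ≤ k} c := by
  induction k with
  | zero =>
    refine ⟨1, fun V G v _ _ hG s hs _ => Finset.card_le_one.2 fun a ha b hb => ?_⟩
    have h1 := hs ha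
    have h2 := hs hb
    simp only [Nat.le_zero, Set.mem_ofPred_eq, hG.dist_eq_zero_iff] at h1 h2
    rw [← h1, ← h2]
  | succ k ih =>
    obtain ⟨c, hc⟩ := ih
    obtain ⟨c', hc'⟩ := exists_indepBoundedOn_nbhd n c
    refine ⟨c', fun V G v hK hS hG s hs hsi => hc' V G _ hK hS (hc V G v hK hS hG) s ?_ hsi⟩
    intro w hw
    have hd : G.dist v w ≤ k + 1 := hs hw
    by_cases hle : G.dist v w ≤ k
    · exact Or.inl hle
    · right
      obtain ⟨q, hq⟩ := hG.exists_walk_length_eq_dist v w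
      have hnil : ¬ q.Nil := fun h => by have := h.length_eq_zero; omega
      refine ⟨q.penultimate, ?_, q.adj_penultimate hnil⟩
      have := SimpleGraph.dist_le q.dropLast
      simp only [Set.mem_ofPred_eq]
      simp at this
      omega

/-- `P` is a set of pairwise disjoint paths of `G` whose vertices are exactly those of `X`. -/
structure IsPathPartitionOn {V : Type} (G : SimpleGraph V) (X : Set V) (P : Finset (List V)) :
    Prop where
  isPath : ∀ l ∈ P, IsPathList G l
  mem_iff : ∀ v, v ∈ X ↔ ∃ l ∈ P, v ∈ l
  disjoint : ∀ l ∈ P, ∀ l' ∈ P, l ≠ l' → ∀ v ∈ l, v ∉ l'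

/-- Two paths with adjacent first vertices can be merged. -/
theorem IsPathPartitionOn.merge {V : Type} [DecidableEq V] {G : SimpleGraph V} {X : Set V}
    {P : Finset (List V)} (hP : IsPathPartitionOn G X P) {a b : V} {l l' : List V}
    (hl : a :: l ∈ P) (hl' : b :: l' ∈ P) (hne : a :: l ≠ b :: l') (hab : G.Adj a b) :
    IsPathPartitionOn G X
      (insert ((a :: l).reverse ++ b :: l') ((P.erase (a :: l)).erase (b :: l'))) where
  isPath := by
    intro m hm
    rcases Finset.mem_insert.1 hm with rfl | hm
    · obtain ⟨-, hn1, hc1⟩ := hP.isPath _ hl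
      obtain ⟨-, hn2, hc2⟩ := hP.isPath _ hl'
      refine ⟨by simp, ?_, ?_⟩
      · refine List.Nodup.append (List.nodup_reverse.2 hn1) hn2 ?_
        intro v hv hv'
        exact hP.disjoint _ hl _ hl' hne v (List.mem_reverse.1 hv) hv'
      · refine List.IsChain.append (List.isChain_reverse.2 ?_) hc2 ?_
        · exact hc1.imp fun _ _ h => h.symm
        · intro x hx y hy
          simp at hx hy
          subst hx hy
          exact hab
    · exact hP.isPath m (Finset.mem_of_mem_erase (Finset.mem_of_mem_erase hm))
  mem_iff := by
    intro v
    rw [hP.mem_iff]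
    constructor
    · rintro ⟨m, hm, hv⟩
      by_cases h1 : m = a :: l
      · exact ⟨_, Finset.mem_insert_self _ _, by simp [← h1, hv]⟩
      by_cases h2 : m = b :: l'
      · exact ⟨_, Finset.mem_insert_self _ _, by simp; grind⟩
      exact ⟨m, by simp [h1, h2, hm], hv⟩
    · rintro ⟨m, hm, hv⟩
      rcases Finset.mem_insert.1 hm with rfl | hm
      · rcases List.mem_append.1 hv with hv | hv
        · exact ⟨_, hl, List.mem_reverse.1 hv⟩
        · exact ⟨_, hl', hv⟩
      · exact ⟨m, Finset.mem_of_mem_erase (Finset.mem_of_mem_erase hm), hv⟩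
  disjoint := by
    have key : ∀ m ∈ (P.erase (a :: l)).erase (b :: l'), ∀ v ∈ m,
        v ∉ (a :: l).reverse ++ b :: l' := by
      intro m hm v hv hv'
      have h2 := (Finset.mem_erase.1 hm)
      have h1 := Finset.mem_erase.1 h2.2
      rcases List.mem_append.1 hv' with hv' | hv'
      · exact hP.disjoint _ h1.2 _ hl h1.1 v hv (List.mem_reverse.1 hv')
      · exact hP.disjoint _ h1.2 _ hl' h2.1 v hv hv'
    intro m hm m' hm' hmm v hv hv'
    rcases Finset.mem_insert.1 hm with rfl | hm <;> rcases Finset.mem_insert.1 hm' with rfl | hm'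
    · exact hmm rfl
    · exact key m' hm' v hv' hv
    · exact key m hm v hv hv'
    · exact hP.disjoint m (Finset.mem_of_mem_erase (Finset.mem_of_mem_erase hm)) m'
        (Finset.mem_of_mem_erase (Finset.mem_of_mem_erase hm')) hmm v hv hv'

/-- The path partition number is at most the independence number. -/
theorem IndepBoundedOn.exists_pathPartition {V : Type} [Fintype V] {G : SimpleGraph V}
    {X : Set V} {c : ℕ} (hX : IndepBoundedOn G X c) :
    ∃ P, IsPathPartitionOn G X P ∧ P.card ≤ c := by
  classical
  have hex : ∃ P, IsPathPartitionOn G X P := by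
    refine ⟨(Finset.univ.filter (· ∈ X)).image (fun v => [v]), ?_, ?_, ?_⟩
    · intro l hl
      obtain ⟨v, -, rfl⟩ := Finset.mem_image.1 hl
      exact ⟨by simp, by simp, by simp [List.Chain']⟩
    · intro v
      simp
    · intro l hl l' hl' hne v hv hv'
      obtain ⟨w, -, rfl⟩ := Finset.mem_image.1 hl
      obtain ⟨w', -, rfl⟩ := Finset.mem_image.1 hl'
      simp at hv hv'
      subst hv hv'
      exact hne rfl
  obtain ⟨P, hP, hmin⟩ := WellFounded.has_min (measure (fun P : Finset (List V) => P.card)).wf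
    {P : Finset (List V) | IsPathPartitionOn G X P} (hex.imp fun _ h => h)
  replace hP : IsPathPartitionOn G X P := hP
  refine ⟨P, hP, ?_⟩
  rcases P.eq_empty_or_nonempty with rfl | ⟨l₀, hl₀⟩
  · simp
  have hhead : ∀ l : List V, ∃ v, l ∈ P → ∃ t, l = v :: t := by
    intro l
    by_cases hl : l ∈ P
    · obtain ⟨v, t, rfl⟩ := List.exists_cons_of_ne_nil (hP.isPath l hl).1
      exact ⟨v, fun _ => ⟨t, rfl⟩⟩
    · exact ⟨l₀.head (hP.isPath l₀ hl₀).1, fun h => (hl h).elim⟩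
  choose g hg using hhead
  have hgmem : ∀ l ∈ P, g l ∈ l := by
    intro l hl
    obtain ⟨t, ht⟩ := hg l hl
    have h1 : g l ∈ g l :: t := List.mem_cons_self
    rwa [← ht] at h1
  have hinj : Set.InjOn g P := by
    intro l hl l' hl' hll
    by_contra hne
    exact hP.disjoint l hl l' hl' hne (g l) (hgmem l hl) (hll ▸ hgmem l' hl')
  rw [← Finset.card_image_of_injOn hinj]
  apply hX
  · intro v hv
    obtain ⟨l, hl, rfl⟩ := Finset.mem_image.1 (Finset.mem_coe.1 hv)
    exact (hP.mem_iff _).2 ⟨l, hl, hgmem l hl⟩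
  · intro a ha b hb hne hab
    obtain ⟨l, hl, rfl⟩ := Finset.mem_image.1 (Finset.mem_coe.1 ha)
    obtain ⟨l', hl', rfl⟩ := Finset.mem_image.1 (Finset.mem_coe.1 hb)
    obtain ⟨t, ht⟩ := hg l hl
    obtain ⟨t', ht'⟩ := hg l' hl'
    have hll : l ≠ l' := fun h => hne (by rw [h])
    have h1 := hP.merge (ht ▸ hl) (ht' ▸ hl') (ht ▸ ht' ▸ hll) hab
    refine hmin _ h1 (lt_of_le_of_lt (Finset.card_insert_le _ _) ?_)
    rw [← ht, ← ht', Finset.card_erase_of_mem (Finset.mem_erase.2 ⟨hll.symm, hl'⟩),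
      Finset.card_erase_of_mem hl]
    change _ < P.card
    have h2 : 1 < P.card := Finset.one_lt_card.2 ⟨l, hl, l', hl', hll⟩
    omega

/-- A geodesic between two vertices of a connected graph. -/
theorem exists_geodesic {V : Type} {G : SimpleGraph V} (hG : G.Connected) (u v : V) :
    ∃ f : ℕ → V, f 0 = u ∧ f (G.dist u v) = v ∧ (∀ i < G.dist u v, G.Adj (f i) (f (i + 1))) ∧
      ∀ i ≤ G.dist u v, G.dist u (f i) = i := by
  obtain ⟨q, hq⟩ := hG.exists_walk_length_eq_dist u v
  refine ⟨q.getVert, q.getVert_zero, hq ▸ q.getVert_length, fun i hi =>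
    q.adj_getVert_succ (by omega), fun i hi => ?_⟩
  have h1 := SimpleGraph.dist_le (q.take i)
  have h2 := SimpleGraph.dist_le (q.drop i)
  have h3 := hG.dist_triangle (u := u) (v := q.getVert i) (w := v)
  simp at h1 h2
  omega

/-- In a geodesic, only consecutive vertices are adjacent. -/
theorem geodesic_adj_iff {V : Type} {G : SimpleGraph V} (hG : G.Connected) {u : V} {k : ℕ}
    {f : ℕ → V} (hf : ∀ i < k, G.Adj (f i) (f (i + 1))) (hd : ∀ i ≤ k, G.dist u (f i) = i)
    {i j : ℕ} (hi : i ≤ k) (hj : j ≤ k) : G.Adj (f i) (f j) ↔ i = j + 1 ∨ j = i + 1 := by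
  constructor
  · intro h
    have h1 := hG.dist_triangle (u := u) (v := f i) (w := f j)
    have h2 := hG.dist_triangle (u := u) (v := f j) (w := f i)
    have h3 := SimpleGraph.dist_eq_one_iff_adj.2 h
    have h4 := SimpleGraph.dist_eq_one_iff_adj.2 h.symm
    have h5 : i ≠ j := fun e => h.ne (by rw [e])
    rw [hd i hi, hd j hj] at h1 h2
    omega
  · rintro (rfl | rfl)
    · exact (hf j (by omega)).symm
    · exact hf i (by omega)

/-- In a `K_{1,n}`-free graph, after each neighbour of `v` on an induced path there is soon a long
segment of the path without neighbours of `v`. -/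
theorem InducedPathOn.exists_gap_right {V : Type} {G : SimpleGraph V} {p : ℤ → V} {lo hi : ℤ}
    {n : ℕ} (hStar : ¬ HasInducedCopyG (StarG n) G) (hp : InducedPathOn G p lo hi) {v : V} {i : ℤ}
    (hlo : lo ≤ i) (hi' : i + n * (n + 4) ≤ hi) (hv : G.Adj v (p i)) :
    ∃ b, i ≤ b ∧ b + (n + 2) ≤ hi ∧ G.Adj v (p b) ∧
      ∀ s, b < s → s ≤ b + (n + 2) → ¬ G.Adj v (p s) := by
  classical
  have hblock : ∃ j : ℕ, j < n ∧ ∀ s : ℤ, i + j * (n + 4) ≤ s → s ≤ i + j * (n + 4) + n + 2 →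
      ¬ G.Adj v (p s) := by
    by_contra! hcon
    have : ∀ j : ℕ, ∃ s : ℤ, j < n → i + j * (n + 4) ≤ s ∧ s ≤ i + j * (n + 4) + n + 2 ∧
        G.Adj v (p s) := by
      intro j
      by_cases hj : j < n
      · obtain ⟨s, hs⟩ := hcon j hj
        exact ⟨s, fun _ => hs⟩
      · exact ⟨0, fun h => (hj h).elim⟩
    choose g hg using this
    have hfar : ∀ j j', j < n → j' < n → j < j' → g j + 2 ≤ g j' := by
      intro j j' hj hj' hjj
      have h1 := hg j hj
      have h2 := hg j' hj'
      have h3 : ((j : ℤ) + 1) * (n + 4) ≤ j' * (n + 4) :=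
        mul_le_mul_of_nonneg_right (by omega) (by omega)
      linarith
    have hrange : ∀ j, j < n → lo ≤ g j ∧ g j ≤ hi := by
      intro j hj
      have h1 := hg j hj
      have h3 : ((j : ℤ) + 1) * (n + 4) ≤ n * (n + 4) :=
        mul_le_mul_of_nonneg_right (by omega) (by omega)
      have h4 : (0 : ℤ) ≤ j * (n + 4) := by positivity
      constructor <;> linarith
    have hpg : ∀ j j', j < n → j' < n → (p (g j) = p (g j') → g j = g j') ∧
        (G.Adj (p (g j)) (p (g j')) ↔ g j = g j' + 1 ∨ g j' = g j + 1) := fun j j' hj hj' =>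
      hp _ _ (hrange j hj).1 (hrange j hj).2 (hrange j' hj').1 (hrange j' hj').2
    have hcard := card_lt_of_starFree hStar (v := v)
      (s := (Finset.range n).image (fun j => p (g j))) ?_ ?_
    · rw [Finset.card_image_of_injOn, Finset.card_range] at hcard
      · exact lt_irrefl _ hcard
      · intro j hj j' hj' hjj
        have h1 : j < n := by simpa using hj
        have h2 : j' < n := by simpa using hj'
        have h3 := (hpg j j' h1 h2).1 hjj
        rcases lt_trichotomy j j' with h | h | h
        · have := hfar j j' h1 h2 h
          omega
        · exact h
        · have := hfar j' j h2 h1 h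
          omega
    · intro x hx y hy hne hadj
      obtain ⟨j, hj, rfl⟩ := Finset.mem_image.1 (Finset.mem_coe.1 hx)
      obtain ⟨j', hj', rfl⟩ := Finset.mem_image.1 (Finset.mem_coe.1 hy)
      have h1 : j < n := by simpa using hj
      have h2 : j' < n := by simpa using hj'
      have h3 := (hpg j j' h1 h2).2.1 hadj
      rcases lt_trichotomy j j' with h | h | h
      · have := hfar j j' h1 h2 h
        omega
      · subst h
        exact hne rfl
      · have := hfar j' j h2 h1 h
        omega
    · intro x hx
      obtain ⟨j, hj, rfl⟩ := Finset.mem_image.1 hx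
      exact (hg j (by simpa using hj)).2.2
  obtain ⟨j, hj, hno⟩ := hblock
  have hj0 : (0 : ℤ) ≤ j * (n + 4) := by positivity
  have hjn : ((j : ℤ) + 1) * (n + 4) ≤ n * (n + 4) :=
    mul_le_mul_of_nonneg_right (by omega) (by omega)
  obtain ⟨b, ⟨hb1, hb2, hb3⟩, hb4⟩ := Int.exists_greatest_of_bdd
    (P := fun s => i ≤ s ∧ s < i + j * (n + 4) ∧ G.Adj v (p s))
    ⟨i + j * (n + 4), fun z hz => hz.2.1.le⟩
    ⟨i, le_rfl, by
      by_contra hcon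
      exact hno i (by linarith) (by linarith) hv, hv⟩
  refine ⟨b, hb1, by linarith, hb3, fun s hs1 hs2 hadj => ?_⟩
  by_cases hs : s < i + j * (n + 4)
  · have := hb4 s ⟨by omega, hs, hadj⟩
    omega
  · exact hno s (by linarith) (by linarith) hadj

/-- The neighbours of an outside vertex on a long induced path, if one of them is far from both
ends, are two to four consecutive vertices. -/
theorem ForkFree.nbrs_consecutive_of_mid {V : Type} {G : SimpleGraph V} {p : ℤ → V} {lo hi : ℤ}
    {n : ℕ} (hF : ForkFree n G) (hStar : ¬ HasInducedCopyG (StarG n) G)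
    (hp : InducedPathOn G p lo hi) {v : V} (hv : ∀ i, lo ≤ i → i ≤ hi → v ≠ p i) {i : ℤ}
    (hlo : lo + n * (n + 4) ≤ i) (hi' : i + n * (n + 4) ≤ hi) (hvi : G.Adj v (p i)) :
    ∃ a b, a + 1 ≤ b ∧ b ≤ a + 3 ∧ a ≤ i ∧ i ≤ b ∧
      ∀ s, lo ≤ s → s ≤ hi → (G.Adj v (p s) ↔ a ≤ s ∧ s ≤ b) := by
  have hnn : (0 : ℤ) ≤ n * (n + 4) := by positivity
  obtain ⟨b, hb1, hb2, hb3, hb4⟩ := hp.exists_gap_right hStar (by linarith) hi' hvi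
  obtain ⟨a', ha1, ha2, ha3, ha4⟩ := (hp.reverse 0).exists_gap_right hStar (v := v) (i := -i)
    (by linarith) (by linarith) (by simpa using hvi)
  obtain ⟨a, rfl⟩ : ∃ a, a' = -a := ⟨-a', by simp⟩
  simp only [zero_sub, neg_neg] at ha1 ha2 ha3 ha4
  have hS : ∀ s, a - (n + 2) ≤ s → s ≤ b + (n + 2) → G.Adj v (p s) → a ≤ s ∧ s ≤ b := by
    intro s h1 h2 h3
    constructor
    · by_contra! hcon
      exact ha4 (-s) (by omega) (by omega) (by simpa using h3)
    · by_contra! hcon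
      exact hb4 s hcon h2 h3
  obtain ⟨h1, h2, h3⟩ := hF.nbrs_consecutive (hp.mono (lo' := a - (n + 2)) (hi' := b + (n + 2))
    (by omega) hb2) (fun i _ _ => hv i (by omega) (by omega)) (by omega) (by omega) (by omega)
    ha3 hb3 hS
  refine ⟨a, b, h1, h2, by omega, hb1, fun s hs1 hs2 => ?_⟩
  by_cases hs : a - (n + 2) ≤ s ∧ s ≤ b + (n + 2)
  · exact h3 s hs.1 hs.2
  refine ⟨fun hadj => ?_, fun _ => by omega⟩
  exfalso
  obtain ⟨t, ht1, ht2, ht3⟩ := hF.exists_adj_of_adj (w := p s)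
    (hp.mono (lo' := a - (n + 1)) (hi' := b + (n + 1)) (by omega) (by omega))
    (fun i _ _ => hv i (by omega) (by omega)) (by omega) (by omega) h1
    (fun t _ _ => h3 t (by omega) (by omega)) (fun t _ _ e => by
      have := (hp s t (by omega) (by omega) (by omega) (by omega)).1 e
      omega) hadj
  have := (hp s t (by omega) (by omega) (by omega) (by omega)).2.1 ht3
  omega

/-- A sequence of disjoint cliques `C 0, …, C N`, each containing a vertex to which the whole next
clique is joined, has a Hamiltonian path. -/
theorem exists_hamiltonian_path_of_cliques {V : Type} [Fintype V] {G : SimpleGraph V}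
    {C : ℕ → Set V} {q : ℕ → V} (N : ℕ) (hq : ∀ t ≤ N, q (t + 1) ∈ C t)
    (hC : ∀ t ≤ N, G.IsClique (C t)) (hadj : ∀ t ≤ N, ∀ v ∈ C t, G.Adj (q t) v)
    (hdisj : ∀ t ≤ N, ∀ t' ≤ N, ∀ v ∈ C t, v ∈ C t' → t = t') :
    ∃ l : List V, IsPathList G l ∧ (∀ v, v ∈ l ↔ ∃ t ≤ N, v ∈ C t) ∧
      l.getLast? = some (q (N + 1)) := by
  classical
  have hblock : ∀ t ≤ N, ∃ l : List V, IsPathList G l ∧ (∀ v, v ∈ l ↔ v ∈ C t) ∧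
      l.getLast? = some (q (t + 1)) := by
    intro t ht
    have hmem : ∀ v, v ∈ ((C t).toFinset.erase (q (t + 1))).toList ++ [q (t + 1)] ↔ v ∈ C t := by
      intro v
      by_cases h : v = q (t + 1)
      · simp [h, hq t ht]
      · simp [h]
    have hnd : (((C t).toFinset.erase (q (t + 1))).toList ++ [q (t + 1)]).Nodup := by
      refine List.Nodup.append (Finset.nodup_toList _) (by simp) ?_
      intro v hv hv'
      simp at hv hv'
      exact hv.1 hv'
    refine ⟨_, ⟨by simp, hnd, ?_⟩, hmem, by simp⟩
    refine List.Pairwise.isChain (hnd.imp_of_mem fun {a b} ha hb hab => ?_)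
    exact hC t ht ((hmem a).1 ha) ((hmem b).1 hb) hab
  induction N with
  | zero =>
    obtain ⟨l, h1, h2, h3⟩ := hblock 0 le_rfl
    exact ⟨l, h1, by simpa using h2, h3⟩
  | succ N ih =>
    obtain ⟨l, ⟨h1, h2, h3⟩, h4, h5⟩ := ih (fun t ht => hq t (by omega)) (fun t ht => hC t (by omega))
      (fun t ht => hadj t (by omega)) (fun t ht t' ht' => hdisj t (by omega) t' (by omega))
      (fun t ht => hblock t (by omega))
    obtain ⟨l', ⟨h1', h2', h3'⟩, h4', h5'⟩ := hblock (N + 1) le_rfl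
    refine ⟨l ++ l', ⟨by simp [h1], List.Nodup.append h2 h2' ?_, List.IsChain.append h3 h3' ?_⟩,
      ?_, ?_⟩
    · intro v hv hv'
      obtain ⟨t, ht, hvt⟩ := (h4 v).1 hv
      have := hdisj t (by omega) (N + 1) le_rfl v hvt ((h4' v).1 hv')
      omega
    · intro x hx y hy
      rw [h5] at hx
      simp at hx
      subst hx
      exact hadj (N + 1) le_rfl y ((h4' y).1 (List.mem_of_mem_head? hy))
    · intro v
      rw [List.mem_append, h4, h4']
      constructor
      · rintro (⟨t, ht, hv⟩ | hv)
        · exact ⟨t, by omega, hv⟩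
        · exact ⟨N + 1, le_rfl, hv⟩
      · rintro ⟨t, ht, hv⟩
        rcases Nat.le_succ_iff.1 ht with ht | rfl
        · exact Or.inl ⟨t, ht, hv⟩
        · exact Or.inr hv
    · rw [List.getLast?_append, h5']
      rfl

/-- The vertices whose first neighbour on the path `p` is `p t`. -/
def pathCluster {V : Type} (G : SimpleGraph V) (p : ℤ → V) (t : ℤ) : Set V :=
  {v | G.Adj v (p t) ∧ ¬ G.Adj v (p (t - 1)) ∧ (v = p (t + 1) ∨ G.Adj v (p (t + 1)))}

namespace ForkFree

variable {V : Type} {G : SimpleGraph V} {p : ℤ → V} {n : ℕ} {m : ℤ}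

theorem mem_pathCluster_self (hp : InducedPathOn G p 0 m) {t : ℤ} (h1 : 1 ≤ t) (h2 : t + 1 ≤ m) :
    p (t + 1) ∈ pathCluster G p t := by
  refine ⟨(hp _ _ (by omega) (by omega) (by omega) (by omega)).2.2 (by omega), fun h => ?_,
    Or.inl rfl⟩
  have := (hp _ _ (by omega) (by omega) (by omega) (by omega)).2.1 h
  omega

/-- The shape of the neighbourhood on the path of a vertex of a cluster. -/
theorem pathCluster_cases (hF : ForkFree n G) (hStar : ¬ HasInducedCopyG (StarG n) G)
    (hp : InducedPathOn G p 0 m) {t : ℤ} (h1 : n * (n + 4) + n + 10 ≤ t)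
    (h2 : t + (n * (n + 4) + n + 10) ≤ m) {v : V} (hv : v ∈ pathCluster G p t) :
    v = p (t + 1) ∨ (∀ i, 0 ≤ i → i ≤ m → v ≠ p i) ∧ ∃ b, t + 1 ≤ b ∧ b ≤ t + 3 ∧
      ∀ s, 0 ≤ s → s ≤ m → (G.Adj v (p s) ↔ t ≤ s ∧ s ≤ b) := by
  have hnn : (0 : ℤ) ≤ n * (n + 4) := by positivity
  obtain ⟨hv1, hv2, hv3⟩ := hv
  by_cases hoff : ∀ i, 0 ≤ i → i ≤ m → v ≠ p i
  · right
    refine ⟨hoff, ?_⟩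
    obtain ⟨a, b, h3, h4, h5, h6, h7⟩ := hF.nbrs_consecutive_of_mid hStar hp hoff (i := t)
      (by omega) (by omega) hv1
    have h8 : a = t := by
      by_contra hne
      exact hv2 ((h7 (t - 1) (by omega) (by omega)).2 (by omega))
    subst h8
    exact ⟨b, h3, h4, h7⟩
  · left
    push Not at hoff
    obtain ⟨s, hs1, hs2, rfl⟩ := hoff
    have h3 := (hp _ _ (by omega) (by omega) (by omega) (by omega)).2.1 hv1
    rcases h3 with rfl | h3
    · rfl
    · rcases hv3 with h4 | h4
      · exact h4
      · have := (hp _ _ (by omega) (by omega) (by omega) (by omega)).2.1 h4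
        omega

theorem pathCluster_isClique (hF : ForkFree n G) (hStar : ¬ HasInducedCopyG (StarG n) G)
    (hp : InducedPathOn G p 0 m) {t : ℤ} (h1 : n * (n + 4) + n + 10 ≤ t)
    (h2 : t + (n * (n + 4) + n + 10) ≤ m) : G.IsClique (pathCluster G p t) := by
  have hnn : (0 : ℤ) ≤ n * (n + 4) := by positivity
  intro v hv w hw hne
  rcases hF.pathCluster_cases hStar hp h1 h2 hv with rfl | ⟨hv1, b, hv2, hv3, hv4⟩
  · rcases hw.2.2 with h | h
    · exact (hne h.symm).elim
    · exact h.symm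
  rcases hF.pathCluster_cases hStar hp h1 h2 hw with rfl | ⟨hw1, b', hw2, hw3, hw4⟩
  · rcases hv.2.2 with h | h
    · exact (hne h).elim
    · exact h
  rcases le_total b b' with hb | hb
  · exact (hF.adj_of_same_first hp hw1 hv1 (by omega) (by omega) hv2 hb hw4 hv4 hne.symm).symm
  · exact hF.adj_of_same_first hp hv1 hw1 (by omega) (by omega) hw2 hb hv4 hw4 hne

theorem pathCluster_disjoint (hF : ForkFree n G) (hStar : ¬ HasInducedCopyG (StarG n) G)
    (hp : InducedPathOn G p 0 m) {t t' : ℤ} (h1 : n * (n + 4) + n + 10 ≤ t)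
    (h2 : t + (n * (n + 4) + n + 10) ≤ m) (h1' : n * (n + 4) + n + 10 ≤ t')
    (h2' : t' + (n * (n + 4) + n + 10) ≤ m) {v : V} (hv : v ∈ pathCluster G p t)
    (hv' : v ∈ pathCluster G p t') : t = t' := by
  have hnn : (0 : ℤ) ≤ n * (n + 4) := by positivity
  rcases hF.pathCluster_cases hStar hp h1 h2 hv with rfl | ⟨hv1, b, hv2, hv3, hv4⟩ <;>
  rcases hF.pathCluster_cases hStar hp h1' h2' hv' with h | ⟨hw1, b', hw2, hw3, hw4⟩
  · have := (hp _ _ (by omega) (by omega) (by omega) (by omega)).1 h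
    omega
  · exact (hw1 _ (by omega) (by omega) rfl).elim
  · exact (hv1 _ (by omega) (by omega) h).elim
  · have h3 := (hv4 t (by omega) (by omega)).2 (by omega)
    have h4 := (hv4 t' (by omega) (by omega))
    have h5 := (hw4 t (by omega) (by omega)).1 h3
    have h6 := h4.1 ((hw4 t' (by omega) (by omega)).2 (by omega))
    omega

/-- Every vertex with a neighbour in the middle of the path lies in a cluster. -/
theorem exists_mem_pathCluster (hF : ForkFree n G) (hStar : ¬ HasInducedCopyG (StarG n) G)
    (hp : InducedPathOn G p 0 m) {s : ℤ} (h1 : n * (n + 4) + n + 10 ≤ s)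
    (h2 : s + (n * (n + 4) + n + 10) ≤ m) {v : V} (hv : G.Adj v (p s)) :
    ∃ t, s - 3 ≤ t ∧ t ≤ s ∧ v ∈ pathCluster G p t := by
  have hnn : (0 : ℤ) ≤ n * (n + 4) := by positivity
  by_cases hoff : ∀ i, 0 ≤ i → i ≤ m → v ≠ p i
  · obtain ⟨a, b, h3, h4, h5, h6, h7⟩ := hF.nbrs_consecutive_of_mid hStar hp hoff (i := s)
      (by omega) (by omega) hv
    refine ⟨a, by omega, h5, (h7 a (by omega) (by omega)).2 (by omega), fun h => ?_,
      Or.inr ((h7 _ (by omega) (by omega)).2 (by omega))⟩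
    have := (h7 _ (by omega) (by omega)).1 h
    omega
  · push Not at hoff
    obtain ⟨i, hi1, hi2, rfl⟩ := hoff
    have h3 := (hp _ _ (by omega) (by omega) (by omega) (by omega)).2.1 hv
    obtain ⟨j, rfl⟩ : ∃ j, i = j + 1 := ⟨i - 1, by omega⟩
    exact ⟨j, by omega, by omega, mem_pathCluster_self hp (by omega) (by omega)⟩

/-- The union of the clusters along the middle of a long induced path has a Hamiltonian path. -/
theorem exists_path_pathCluster [Fintype V] (hF : ForkFree n G)
    (hStar : ¬ HasInducedCopyG (StarG n) G) (hp : InducedPathOn G p 0 m) {A B : ℤ}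
    (hA : n * (n + 4) + n + 10 ≤ A) (hAB : A ≤ B) (hB : B + (n * (n + 4) + n + 10) ≤ m) :
    ∃ l : List V, IsPathList G l ∧ ∀ v, v ∈ l ↔ ∃ t, A ≤ t ∧ t ≤ B ∧ v ∈ pathCluster G p t := by
  have hnn : (0 : ℤ) ≤ n * (n + 4) := by positivity
  obtain ⟨l, h1, h2, -⟩ := exists_hamiltonian_path_of_cliques (G := G)
    (C := fun t => pathCluster G p (A + t)) (q := fun t => p (A + t)) (B - A).toNat
    (fun t ht => by
      have := mem_pathCluster_self hp (t := A + t) (by omega) (by omega)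
      simpa [add_assoc] using this)
    (fun t ht => hF.pathCluster_isClique hStar hp (by omega) (by omega))
    (fun t ht v hv => hv.1.symm)
    (fun t ht t' ht' v hv hv' => by
      have := hF.pathCluster_disjoint hStar hp (by omega) (by omega) (by omega) (by omega) hv hv'
      omega)
  refine ⟨l, h1, fun v => (h2 v).trans ?_⟩
  constructor
  · rintro ⟨t, ht, hv⟩
    exact ⟨A + t, by omega, by omega, hv⟩
  · rintro ⟨t, ht1, ht2, hv⟩
    exact ⟨(t - A).toNat, by omega, by rwa [show A + ((t - A).toNat : ℤ) = t by omega]⟩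

end ForkFree

namespace InducedPathOn

variable {V : Type} {G : SimpleGraph V} {p : ℤ → V} {n : ℕ} {m : ℤ}

theorem dist_le (hG : G.Connected) {lo hi : ℤ} (hp : InducedPathOn G p lo hi) {a : ℤ}
    (ha : lo ≤ a) (j : ℕ) (hj : a + j ≤ hi) : G.dist (p (a + j)) (p a) ≤ j := by
  induction j with
  | zero => simp
  | succ j ih =>
    have h1 := ih (by omega)
    have h2 := hG.dist_triangle (u := p (a + (j + 1 : ℕ))) (v := p (a + j)) (w := p a)
    have h3 : G.Adj (p (a + (j + 1 : ℕ))) (p (a + j)) :=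
      (hp _ _ (by omega) (by omega) (by omega) (by omega)).2.2 (by omega)
    have h4 := SimpleGraph.dist_eq_one_iff_adj.2 h3
    omega

/-- A geodesic ending next to the induced path `p` can be continued along `p`. -/
theorem append_geodesic (hG : G.Connected) (hp : InducedPathOn G p 0 m) {f : ℕ → V} {h : V}
    {k : ℕ} (hf : ∀ i < k, G.Adj (f i) (f (i + 1))) (hd : ∀ i ≤ k, G.dist h (f i) = i)
    {A B b : ℤ} (hA : 0 ≤ A) (hAb : A ≤ b) (hbB : b + 2 ≤ B) (hB : B ≤ m)
    (hno : ∀ j < k, ∀ s, A ≤ s → s ≤ B → ¬ G.Adj (f j) (p s)) (hkb : G.Adj (f k) (p b))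
    (hk : ∀ s, b < s → s ≤ B → ¬ G.Adj (f k) (p s)) :
    InducedPathOn G (fun i => if i ≤ k then f i.toNat else p (b + (i - k - 1)))
      0 (k + 1 + B - b) := by
  have hne : ∀ j ≤ k, ∀ s, b ≤ s → s ≤ B → f j ≠ p s := by
    intro j hj s hs1 hs2 e
    have h1 : ∀ s', b ≤ s' → s' ≤ B → (s = s' + 1 ∨ s' = s + 1) → G.Adj (f j) (p s') := by
      intro s' h2 h3 h4
      rw [e]
      exact (hp _ _ (by omega) (by omega) (by omega) (by omega)).2.2 h4
    rcases lt_or_eq_of_le hj with hj | rfl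
    · by_cases h2 : s + 1 ≤ B
      · exact hno j hj (s + 1) (by omega) h2 (h1 _ (by omega) h2 (by omega))
      · exact hno j hj (s - 1) (by omega) (by omega) (h1 _ (by omega) (by omega) (by omega))
    · by_cases h2 : s + 1 ≤ B
      · exact hk (s + 1) (by omega) h2 (h1 _ (by omega) h2 (by omega))
      · exact hk (s - 1) (by omega) (by omega) (h1 _ (by omega) (by omega) (by omega))
  have hadj : ∀ j ≤ k, ∀ s, b ≤ s → s ≤ B → (G.Adj (f j) (p s) ↔ j = k ∧ s = b) := by
    intro j hj s hs1 hs2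
    constructor
    · intro h1
      have h2 : j = k := by
        by_contra h2
        exact hno j (by omega) s (by omega) hs2 h1
      subst h2
      refine ⟨rfl, ?_⟩
      by_contra h3
      exact hk s (by omega) hs2 h1
    · rintro ⟨rfl, rfl⟩
      exact hkb
  intro i j hi1 hi2 hj1 hj2
  dsimp only
  split_ifs with h1 h2 h2
  · refine ⟨fun e => ?_, (geodesic_adj_iff hG hf hd (by omega) (by omega)).trans (by omega)⟩
    have h3 := hd i.toNat (by omega)
    rw [e, hd j.toNat (by omega)] at h3
    omega
  · refine ⟨fun e => (hne _ (by omega) _ (by omega) (by omega) e).elim, ?_⟩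
    rw [hadj _ (by omega) _ (by omega) (by omega)]
    omega
  · refine ⟨fun e => (hne _ (by omega) _ (by omega) (by omega) e.symm).elim, ?_⟩
    rw [G.adj_comm, hadj _ (by omega) _ (by omega) (by omega)]
    omega
  · have h3 := hp (b + (i - k - 1)) (b + (j - k - 1)) (by omega) (by omega) (by omega) (by omega)
    refine ⟨fun e => by have := h3.1 e; omega, h3.2.trans (by omega)⟩

/-- A vertex from which a geodesic reaches a longest induced path near one end is close to that
end. -/
theorem dist_le_of_longest (hG : G.Connected) (hp : InducedPathOn G p 0 m)
    (hmax : ∀ (q : ℤ → V) (m' : ℤ), InducedPathOn G q 0 m' → m' ≤ m) {f : ℕ → V} {h : V}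
    {k : ℕ} (hf : ∀ i < k, G.Adj (f i) (f (i + 1))) (hd : ∀ i ≤ k, G.dist h (f i) = i)
    {A : ℕ} {b : ℤ} (hAb : A ≤ b) (hbn : b ≤ A + n + 5) (hm : 2 * A + n + 7 ≤ m)
    (hno : ∀ j < k, ∀ s : ℤ, A ≤ s → s ≤ m - A → ¬ G.Adj (f j) (p s)) (hkb : G.Adj (f k) (p b))
    (hk : ∀ s, b < s → s ≤ m - A → ¬ G.Adj (f k) (p s)) :
    G.dist (p A) h ≤ 2 * A + 2 * n + 20 := by
  have h1 := hmax _ _ (hp.append_geodesic hG hf hd (B := m - A) (by omega) hAb (by omega)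
    (by omega) hno hkb hk)
  have h2 := hp.dist_le hG (a := A) (by omega) (b - A).toNat (by omega)
  rw [show (A : ℤ) + (b - A).toNat = b by omega] at h2
  have h3 := SimpleGraph.dist_eq_one_iff_adj.2 hkb
  have h4 := hG.dist_triangle (u := h) (v := f k) (w := p b)
  have h5 := hG.dist_triangle (u := h) (v := p b) (w := p A)
  have h6 := hd k le_rfl
  rw [SimpleGraph.dist_comm]
  omega

/-- Vertices without neighbours in the middle of a longest induced path are close to one of its
ends. -/
theorem dist_le_or_dist_le (hG : G.Connected) (hF : ForkFree n G)
    (hStar : ¬ HasInducedCopyG (StarG n) G) (hp : InducedPathOn G p 0 m)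
    (hmax : ∀ (q : ℤ → V) (m' : ℤ), InducedPathOn G q 0 m' → m' ≤ m) {A : ℕ}
    (hA : n * (n + 4) + 1 ≤ A) (hm : 2 * A + n + 10 ≤ m) {h : V}
    (hh : ∀ s : ℤ, A ≤ s → s ≤ m - A → ¬ G.Adj h (p s)) :
    G.dist (p A) h ≤ 2 * A + 2 * n + 20 ∨ G.dist (p (m - A)) h ≤ 2 * A + 2 * n + 20 := by
  have hAz : ((n * (n + 4) + 1 : ℕ) : ℤ) ≤ A := by exact_mod_cast hA
  push_cast at hAz
  have hnn : (0 : ℤ) ≤ n * (n + 4) := by positivity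
  obtain ⟨τ, ⟨s', hs1, hs2, hτ⟩, hmin⟩ := WellFounded.has_min (measure (fun v : V => G.dist h v)).wf
    {v : V | ∃ s : ℤ, A ≤ s ∧ s ≤ m - A ∧ G.Adj v (p s)}
    ⟨p (A + 1), A, le_rfl, by omega,
      (hp _ _ (by omega) (by omega) (by omega) (by omega)).2.2 (by omega)⟩
  obtain ⟨f, hf0, hfk, hf, hd⟩ := exists_geodesic hG h τ
  set k := G.dist h τ with hk
  have hno : ∀ j < k, ∀ s : ℤ, A ≤ s → s ≤ m - A → ¬ G.Adj (f j) (p s) := by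
    intro j hj s h1 h2 h3
    refine hmin (f j) ⟨s, h1, h2, h3⟩ ?_
    change G.dist h (f j) < G.dist h τ
    rw [hd j hj.le]
    exact hj
  have hk0 : 0 < k := by
    by_contra hk0
    have h1 : k = 0 := by omega
    rw [h1, hf0] at hfk
    exact hh s' hs1 hs2 (hfk ▸ hτ)
  have hlast : G.Adj τ (f (k - 1)) := by
    have := hf (k - 1) (by omega)
    rw [Nat.sub_add_cancel hk0, hfk] at this
    exact this.symm
  have hnol := hno (k - 1) (by omega)
  have left : ∀ b : ℤ, A ≤ b → b ≤ A + n + 5 → G.Adj τ (p b) →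
      (∀ s, b < s → s ≤ m - A → ¬ G.Adj τ (p s)) → G.dist (p A) h ≤ 2 * A + 2 * n + 20 := by
    intro b h1 h2 h3 h4
    exact hp.dist_le_of_longest hG hmax hf hd h1 h2 (by omega) hno (hfk.symm ▸ h3)
      (hfk.symm ▸ h4)
  have right : ∀ b : ℤ, m - A - n - 5 ≤ b → b ≤ m - A → G.Adj τ (p b) →
      (∀ s : ℤ, A ≤ s → s < b → ¬ G.Adj τ (p s)) →
      G.dist (p (m - A)) h ≤ 2 * A + 2 * n + 20 := by
    intro b h1 h2 h3 h4
    have hrev := hp.reverse m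
    rw [sub_self, sub_zero] at hrev
    refine hrev.dist_le_of_longest hG hmax (b := m - b) hf hd (by omega) (by omega) (by omega)
      (fun j hj s hs1 hs2 => hno j hj _ (by omega) (by omega)) ?_ ?_
    · rw [hfk, sub_sub_cancel]
      exact h3
    · intro s hs1 hs2
      rw [hfk]
      exact h4 _ (by omega) (by omega)
  by_cases hoff : ∀ i, 0 ≤ i → i ≤ m → τ ≠ p i
  · obtain ⟨a, b, h3, h4, h5, h6, h7⟩ := hF.nbrs_consecutive_of_mid hStar hp hoff (i := s')
      (by omega) (by omega) hτ
    by_cases hb : b ≤ A + n + 5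
    · refine Or.inl (left b (by omega) hb ((h7 b (by omega) (by omega)).2 (by omega)) ?_)
      intro s hs1 hs2 hs3
      have := (h7 s (by omega) (by omega)).1 hs3
      omega
    by_cases ha : m - A - n - 5 ≤ a
    · refine Or.inr (right a ha (by omega) ((h7 a (by omega) (by omega)).2 (by omega)) ?_)
      intro s hs1 hs2 hs3
      have := (h7 s (by omega) (by omega)).1 hs3
      omega
    exfalso
    by_cases hw : ∀ i, 0 ≤ i → i ≤ m → f (k - 1) ≠ p i
    · obtain ⟨i, hi1, hi2, hi3⟩ := hF.exists_adj_of_adj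
        (hp.mono (lo' := a - (n + 1)) (hi' := b + (n + 1)) (by omega) (by omega))
        (fun i _ _ => hoff i (by omega) (by omega)) (by omega) (by omega) h3
        (fun i _ _ => h7 i (by omega) (by omega)) (fun i _ _ => hw i (by omega) (by omega)) hlast
      exact hnol i (by omega) (by omega) hi3
    · push Not at hw
      obtain ⟨i, hi1, hi2, hi3⟩ := hw
      have h8 := (h7 i hi1 hi2).1 (hi3 ▸ hlast)
      refine hnol (i + 1) (by omega) (by omega) ?_
      rw [hi3]
      exact (hp _ _ (by omega) (by omega) (by omega) (by omega)).2.2 (by omega)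
  · push Not at hoff
    obtain ⟨i, hi1, hi2, rfl⟩ := hoff
    have h3 := (hp _ _ (by omega) (by omega) (by omega) (by omega)).2.1 hτ
    have h4 : i < A ∨ m - A < i := by
      by_contra! h4
      exact hnol i h4.1 h4.2 hlast.symm
    rcases h4 with h4 | h4
    · obtain rfl : s' = A := by omega
      refine Or.inl (left A le_rfl (by omega) hτ fun s hs1 hs2 hs3 => ?_)
      have := (hp _ _ (by omega) (by omega) (by omega) (by omega)).2.1 hs3
      omega
    · obtain rfl : s' = m - A := by omega
      refine Or.inr (right (m - A) (by omega) le_rfl hτ fun s hs1 hs2 hs3 => ?_)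
      have := (hp _ _ (by omega) (by omega) (by omega) (by omega)).2.1 hs3
      omega

/-- Every finite nonempty graph has a longest induced path. -/
theorem exists_longest [Fintype V] [Nonempty V] (G : SimpleGraph V) :
    ∃ (p : ℤ → V) (m : ℤ), InducedPathOn G p 0 m ∧
      ∀ (q : ℤ → V) (m' : ℤ), InducedPathOn G q 0 m' → m' ≤ m := by
  obtain ⟨m, ⟨p, hp⟩, hmax⟩ := Int.exists_greatest_of_bdd
    (P := fun z => ∃ p : ℤ → V, InducedPathOn G p 0 z)
    ⟨Fintype.card V, fun z ⟨p, hp⟩ => by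
      have := Finset.card_le_card_of_injOn p (s := Finset.Icc 0 z) (t := Finset.univ)
        (fun _ _ => Finset.mem_coe.2 (Finset.mem_univ _)) (fun i hi j hj e => by
          rw [Finset.mem_coe, Finset.mem_Icc] at hi hj
          exact (hp i j hi.1 hi.2 hj.1 hj.2).1 e)
      rw [Int.card_Icc, Finset.card_univ] at this
      omega⟩
    ⟨-1, fun _ => Classical.arbitrary V, fun i j h1 h2 h3 h4 => by omega⟩
  exact ⟨p, m, hp, fun q m' hq => hmax m' ⟨q, hq⟩⟩

/-- Distances are at most the length of a longest induced path. -/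
theorem dist_le_longest (hG : G.Connected)
    (hmax : ∀ (q : ℤ → V) (m' : ℤ), InducedPathOn G q 0 m' → m' ≤ m) (u v : V) :
    (G.dist u v : ℤ) ≤ m := by
  obtain ⟨f, -, -, hf, hd⟩ := exists_geodesic hG u v
  refine hmax (fun i => f i.toNat) _ fun i j hi1 hi2 hj1 hj2 => ⟨fun e => ?_, ?_⟩
  · have h1 := hd i.toNat (by omega)
    rw [show f i.toNat = f j.toNat from e, hd j.toNat (by omega)] at h1
    omega
  · exact (geodesic_adj_iff hG hf hd (by omega) (by omega)).trans (by omega)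

end InducedPathOn

theorem IndepBoundedOn.subset {V : Type} {G : SimpleGraph V} {X Y : Set V} {c : ℕ}
    (hX : IndepBoundedOn G X c) (h : Y ⊆ X) : IndepBoundedOn G Y c :=
  fun s hs => hX s (hs.trans h)

theorem IndepBoundedOn.union {V : Type} {G : SimpleGraph V} {X Y : Set V} {c c' : ℕ}
    (hX : IndepBoundedOn G X c) (hY : IndepBoundedOn G Y c') :
    IndepBoundedOn G (X ∪ Y) (c + c') := by
  classical
  intro s hs hsi
  have h1 := Finset.card_filter_add_card_filter_not (s := s) (fun v => v ∈ X)
  have h2 := hX (s.filter (· ∈ X)) (fun v hv => (Finset.mem_filter.1 (Finset.mem_coe.1 hv)).2)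
    (hsi.mono (Finset.coe_subset.2 (Finset.filter_subset _ _)))
  have h3 := hY (s.filter (· ∉ X)) (fun v hv => by
    obtain ⟨hv1, hv2⟩ := Finset.mem_filter.1 (Finset.mem_coe.1 hv)
    exact (hs hv1).resolve_left hv2)
    (hsi.mono (Finset.coe_subset.2 (Finset.filter_subset _ _)))
  omega

theorem IsPathPartitionOn.ppG_le {V : Type} {G : SimpleGraph V} {P : Finset (List V)}
    (hP : IsPathPartitionOn G Set.univ P) : ppG G ≤ P.card :=
  Nat.sInf_le ⟨P, rfl, hP.isPath, fun v => (hP.mem_iff v).1 trivial, hP.disjoint⟩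

theorem IsPathPartitionOn.insert {V : Type} [DecidableEq V] {G : SimpleGraph V} {X : Set V}
    {P : Finset (List V)} (hP : IsPathPartitionOn G X P) {l : List V} (hl : IsPathList G l)
    (hlX : ∀ v, v ∈ l ↔ v ∉ X) : IsPathPartitionOn G Set.univ (insert l P) where
  isPath := by
    intro l' hl'
    rcases Finset.mem_insert.1 hl' with rfl | hl'
    · exact hl
    · exact hP.isPath l' hl'
  mem_iff := by
    intro v
    refine ⟨fun _ => ?_, fun _ => trivial⟩
    by_cases hv : v ∈ X
    · obtain ⟨l', hl', hvl⟩ := (hP.mem_iff v).1 hv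
      exact ⟨l', Finset.mem_insert_of_mem hl', hvl⟩
    · exact ⟨l, Finset.mem_insert_self _ _, (hlX v).2 hv⟩
  disjoint := by
    intro l₁ h₁ l₂ h₂ hne v hv₁ hv₂
    rcases Finset.mem_insert.1 h₁ with rfl | hm₁ <;>
      rcases Finset.mem_insert.1 h₂ with rfl | hm₂
    · exact hne rfl
    · exact (hlX v).1 hv₁ ((hP.mem_iff v).2 ⟨l₂, hm₂, hv₂⟩)
    · exact (hlX v).1 hv₂ ((hP.mem_iff v).2 ⟨l₁, hm₁, hv₁⟩)
    · exact hP.disjoint l₁ hm₁ l₂ hm₂ hne v hv₁ hv₂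

/-- Chiba–Furuya. For every `n ≥ 2` there is a constant `c′₀ = c′₀(n)`
such that `pp(G) ≤ c′₀` for every connected
`{K*_n, K_{1,n}, F^(1)_n, F^(2)_n, F^(3)_n, F^(4)_n}`-free graph `G`. -/
theorem ppG_bounded_of_F'1 (n : ℕ) (hn : 2 ≤ n) :
    ∃ c : ℕ, ∀ (V : Type) (_ : Fintype V) (G : SimpleGraph V),
      G.Connected →
      ¬ HasInducedCopyG (KStarG n) G →
      ¬ HasInducedCopyG (StarG n) G →
      ¬ HasInducedCopyG (F1G n) G →
      ¬ HasInducedCopyG (F2G n) G →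
      ¬ HasInducedCopyG (F3G n) G →
      ¬ HasInducedCopyG (F4G n) G →
      ppG G ≤ c := by
  classical
  set A : ℕ := n * (n + 4) + n + 13 with hA
  obtain ⟨c₁, hc₁⟩ := exists_indepBoundedOn_ball n (2 * A + n + 10)
  obtain ⟨c₂, hc₂⟩ := exists_indepBoundedOn_ball n (2 * A + 2 * n + 20)
  refine ⟨c₁ + (c₂ + c₂ + 1), fun V _ G hG hK hS hF1 hF2 hF3 hF4 => ?_⟩
  have hF : ForkFree n G := ⟨by omega, hF1, hF2, hF3, hF4⟩
  have := hG.nonempty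
  obtain ⟨p, m, hp, hmax⟩ := InducedPathOn.exists_longest G
  by_cases hm : m < 2 * A + n + 10
  · have hX : IndepBoundedOn G Set.univ c₁ :=
      (hc₁ V G (p 0) hK hS hG).subset fun v _ => by
        have := InducedPathOn.dist_le_longest hG hmax (p 0) v
        rw [Set.mem_ofPred_eq]
        omega
    obtain ⟨P, hP, hcard⟩ := hX.exists_pathPartition
    exact hP.ppG_le.trans (by omega)
  · have hAz : (A : ℤ) = n * (n + 4) + n + 13 := by exact_mod_cast hA
    obtain ⟨l, hl, hlmem⟩ := hF.exists_path_pathCluster hS hp (A := A - 3) (B := m - A)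
      (by omega) (by omega) (by omega)
    have hX : IndepBoundedOn G {v | v ∉ l} (c₂ + c₂) := by
      refine ((hc₂ V G (p A) hK hS hG).union (hc₂ V G (p (m - A)) hK hS hG)).subset ?_
      intro v hv
      refine hp.dist_le_or_dist_le hG hF hS hmax (by omega) (by omega) fun s hs1 hs2 hadj => hv ?_
      obtain ⟨t, ht1, ht2, ht3⟩ := hF.exists_mem_pathCluster hS hp (by omega) (by omega) hadj
      exact (hlmem v).2 ⟨t, by omega, by omega, ht3⟩
    obtain ⟨P, hP, hcard⟩ := hX.exists_pathPartition
    have h1 := (hP.insert hl fun v => not_not.symm).ppG_le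
    have h2 := Finset.card_insert_le l P
    omega
end
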